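/- arXiv:1912.04745 — 2 statements merged into one kernel-verified Lean document; each statement's English description precedes it below -/
import Mathlib

section
/- Assume gcd(s+l,2l) = gcd(s,l) = d and d is even. Then the number of quadruples (a,b,c,h) ∈ F_{p^s} × F_q × F_q × F_p for which the codeword c(a,b,c,h) has Hamming weight p^{s−1}(p−1)(p^s − 1) equals p^{m+d}(p^s+1)(p^m−1)/(2(p^d+1)). -/
/-- `trp p r z = z + z^p + ⋯ + z^(p^(r-1))`, the trace form used for `Tr_r`. -/
def trp (p r : ℕ) {F : Type} [Field F] (z : F) : F :=
  ∑ i ∈ Finset.range r, z ^ p ^ i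

/-- The codeword `c(a,b,c,h)` of the code `C`, viewed as a function on `F_q = F`;
its value at `x` is `Tr_s(a x^(p^s+1)) + Tr_m(b x^(p^l+1) + c x) + h` (the values
lie in the prime field `F_p ⊆ F`). Here `m = 2s`. -/
def cword (p s l : ℕ) {F : Type} [Field F] (a b c : F) (h : ZMod p) : F → F :=
  fun x => trp p s (a * x ^ (p ^ s + 1)) + trp p (2 * s) (b * x ^ (p ^ l + 1) + c * x)
    + ZMod.cast h

/-- The support of the codeword `c(a,b,c,h)`; its cardinality is the Hamming weight. -/
def suppw (p s l : ℕ) {F : Type} [Field F] [Fintype F] [DecidableEq F]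
    (a b c : F) (h : ZMod p) : Finset F :=
  Finset.univ.filter fun x => cword p s l a b c h x ≠ 0

section
open Finset

/-- A finite field with two commuting automorphisms `σ`, `τ`, `τ` an involution, and a nonzero
additive functional `tr` to the prime field which both leave invariant. In the application both
are powers of Frobenius and `tr` is the absolute trace. -/
structure KasamiData (p : ℕ) (F : Type) [Field F] [Fintype F] [DecidableEq F] where
  σ : F ≃+* F
  τ : F ≃+* F
  tr : F →+ ZMod p
  P : ℕ
  u : ℕ
  odd_p : Odd p
  two_ne : (2 : F) ≠ 0
  one_lt_P : 1 < P
  one_lt_u : 1 < u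
  odd_u : Odd u
  tr_σ : ∀ x, tr (σ x) = tr x
  tr_τ : ∀ x, tr (τ x) = tr x
  tr_ne : ∃ x, tr x ≠ 0
  τ_τ : ∀ x, τ (τ x) = x
  τ_σ : ∀ x, τ (σ x) = σ (τ x)
  eq_zero_of_neg : ∀ v, σ v = -v → τ v = -v → v = 0
  τ_eq_of_σ_eq : ∀ z, σ z = τ z → τ z = z
  exists_sq : ∀ y : ZMod p, y ≠ 0 → ∃ i : F, (∀ x, tr (i ^ 2 * x) = y * tr x) ∧ i ≠ 0 ∧
    σ i = i ∧ τ i = i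
  card_F : Fintype.card F = P ^ 2
  card_K : #{x | τ x = x} = P
  card_k : #{x | σ x = τ x} = u

namespace KasamiData

variable {p : ℕ} [Fact p.Prime] {F : Type} [Field F] [Fintype F] [DecidableEq F]
  (S : KasamiData p F)

/-- The additive character attached to `tr`. -/
noncomputable def ψ : AddChar F ℂ := ZMod.stdAddChar.compAddMonoidHom S.tr

/-- The fixed field of `τ`. -/
def K : Finset F := {x | S.τ x = x}

/-- The fixed field of `σ * τ⁻¹`. -/
def k : Finset F := {x | S.σ x = S.τ x}

/-- The quadratic form is `tr (q a b x)`. -/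
def q (a b x : F) : F := a * (x * S.τ x) / 2 + b * (x * S.σ x)

/-- The self-adjoint operator attached to the quadratic form. -/
def L (a b x : F) : F := a * S.τ x + b * S.σ x + S.σ.symm (b * x)

/-- The radical of the quadratic form. -/
def R (a b : F) : Finset F := {x | S.L a b x = 0}

/-- The exponential sum of the quadratic form. -/
noncomputable def T (a b : F) : ℂ := ∑ x, S.ψ (S.q a b x)

omit [Fact p.Prime] in
theorem mem_K {x : F} : x ∈ S.K ↔ S.τ x = x := by simp [K]

omit [Fact p.Prime] in
theorem mem_k {x : F} : x ∈ S.k ↔ S.σ x = S.τ x := by simp [k]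

omit [Fact p.Prime] in
theorem mem_R {a b x : F} : x ∈ S.R a b ↔ S.L a b x = 0 := by simp [R]

omit [Fact p.Prime] in
theorem tr_symm (x : F) : S.tr (S.σ.symm x) = S.tr x := by
  rw [← S.tr_σ (S.σ.symm x), RingEquiv.apply_symm_apply]

omit [Fact p.Prime] in
theorem τ_symm (x : F) : S.τ (S.σ.symm x) = S.σ.symm (S.τ x) := by
  apply S.σ.injective
  rw [← S.τ_σ, RingEquiv.apply_symm_apply, RingEquiv.apply_symm_apply]

omit [Fact p.Prime] in
theorem mem_K_of_mem_k {z : F} (hz : z ∈ S.k) : z ∈ S.K :=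
  S.mem_K.2 (S.τ_eq_of_σ_eq z (S.mem_k.1 hz))

omit [Fact p.Prime] in
theorem σ_of_mem_k {z : F} (hz : z ∈ S.k) : S.σ z = z := by
  rw [S.mem_k.1 hz, S.mem_K.1 (S.mem_K_of_mem_k hz)]

omit [Fact p.Prime] in
theorem mem_k_iff {z : F} : z ∈ S.k ↔ S.σ z = z ∧ S.τ z = z :=
  ⟨fun h => ⟨S.σ_of_mem_k h, S.mem_K.1 (S.mem_K_of_mem_k h)⟩, fun h => S.mem_k.2 (by rw [h.1, h.2])⟩

theorem ψ_apply (x : F) : S.ψ x = ZMod.stdAddChar (S.tr x) := rfl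

theorem ψ_congr {x y : F} (h : S.tr x = S.tr y) : S.ψ x = S.ψ y := by
  rw [ψ_apply, ψ_apply, h]

theorem isPrimitive_ψ : S.ψ.IsPrimitive := by
  intro a ha h
  obtain ⟨x, hx⟩ := S.tr_ne
  have h1 := DFunLike.congr_fun h (a⁻¹ * x)
  rw [AddChar.mulShift_apply, mul_inv_cancel_left₀ ha, ψ_apply, AddChar.one_apply] at h1
  apply hx
  apply ZMod.injective_stdAddChar
  rw [h1, AddChar.map_zero_eq_one]

theorem sum_ψ (b : F) : ∑ x, S.ψ (x * b) = if b = 0 then (S.P : ℂ) ^ 2 else 0 := by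
  rw [AddChar.sum_mulShift b S.isPrimitive_ψ, S.card_F]
  split_ifs <;> simp

omit [Fact p.Prime] in
theorem card_F_ne : (S.P : ℂ) ^ 2 ≠ 0 := by
  have := S.one_lt_P
  exact pow_ne_zero _ (Nat.cast_ne_zero.2 (by omega))

/-- Fibres of an additive map in terms of the kernel of its adjoint. -/
theorem card_fiber {f g : F → F} (h : ∀ x z, S.tr (z * f x) = S.tr (x * g z)) (w : F) :
    (#{x | f x = w} : ℂ) = ∑ z with g z = 0, S.ψ (-(z * w)) := by
  apply mul_left_cancel₀ S.card_F_ne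
  have h1 : (S.P : ℂ) ^ 2 * #{x | f x = w} = ∑ x, ∑ z, S.ψ (z * (f x - w)) := by
    simp_rw [S.sum_ψ, sub_eq_zero]
    rw [← sum_filter, sum_const, nsmul_eq_mul, mul_comm]
  rw [h1, sum_comm, sum_filter, mul_sum]
  refine sum_congr rfl fun z _ => ?_
  have h2 : ∀ x, S.ψ (z * (f x - w)) = S.ψ (x * g z) * S.ψ (-(z * w)) := by
    intro x
    rw [mul_sub, sub_eq_add_neg, AddChar.map_add_eq_mul, S.ψ_congr (h x z)]
  simp_rw [h2, ← sum_mul, S.sum_ψ]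
  split_ifs <;> simp

omit [Fact p.Prime] in
theorem tr_L_symm {a : F} (ha : a ∈ S.K) (b x y : F) :
    S.tr (y * S.L a b x) = S.tr (x * S.L a b y) := by
  have h1 : S.tr (y * (a * S.τ x)) = S.tr (x * (a * S.τ y)) := by
    rw [← S.tr_τ]; simp only [map_mul, S.τ_τ, S.mem_K.1 ha]; congr 1; ring
  have h2 : ∀ x y, S.tr (y * (b * S.σ x)) = S.tr (x * S.σ.symm (b * y)) := by
    intro x y
    rw [← S.tr_symm]; simp only [map_mul, RingEquiv.symm_apply_apply]; congr 1; ring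
  simp only [L, mul_add, map_add]
  rw [h1, h2 x y, ← h2 y x]; ring

theorem tr_q_add {a : F} (ha : a ∈ S.K) (b x y : F) :
    S.tr (S.q a b (x + y)) = S.tr (S.q a b x) + S.tr (S.q a b y) + S.tr (y * S.L a b x) := by
  have h1 : S.tr (a * (x * S.τ y) / 2) = S.tr (y * (a * S.τ x) / 2) := by
    rw [← S.tr_τ]; simp only [map_mul, map_div₀, map_ofNat, S.τ_τ, S.mem_K.1 ha]; congr 1; ring
  have h2 : S.tr (b * (x * S.σ y)) = S.tr (y * S.σ.symm (b * x)) := by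
    rw [← S.tr_symm]; simp only [map_mul, RingEquiv.symm_apply_apply]; congr 1; ring
  have h3 : S.q a b (x + y) = S.q a b x + S.q a b y + (a * (x * S.τ y) / 2 + y * (a * S.τ x) / 2)
      + y * (b * S.σ x) + b * (x * S.σ y) := by
    simp only [q, map_add]; ring
  have h4 : S.tr (y * (a * S.τ x)) = S.tr (y * (a * S.τ x) / 2) + S.tr (y * (a * S.τ x) / 2) := by
    rw [← map_add]; congr 1; field_simp [S.two_ne]; norm_num
  rw [h3]
  simp only [L, map_add, mul_add, h1, h2, h4]; ring

omit [Fact p.Prime] in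
theorem q_mul (a b c x : F) : S.q a b (c * x) = S.q (a * (c * S.τ c)) (b * (c * S.σ c)) x := by
  simp only [q, map_mul]; ring

omit [Fact p.Prime] in
theorem q_zero (a b : F) : S.q a b 0 = 0 := by simp [q]

omit [Fact p.Prime] in
theorem L_scale (a b c x : F) :
    S.L (a * (c * S.τ c)) (b * (c * S.σ c)) x = c * S.L a b (c * x) := by
  simp only [L, map_mul, RingEquiv.symm_apply_apply]; ring

omit [Fact p.Prime] in
theorem q_smul {i : F} (h1 : S.σ i = i) (h2 : S.τ i = i) (a b x : F) :
    S.q a b (i * x) = i ^ 2 * S.q a b x := by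
  simp only [q, map_mul, h1, h2]; ring

theorem sum_ψ_neg (a b : F) : ∑ x, S.ψ (-S.q a b x) = S.T a b := by
  obtain ⟨i, h1, h2, h3, h4⟩ := S.exists_sq (-1) (by simp)
  rw [T, ← Equiv.sum_comp (Equiv.mulLeft₀ i h2)]
  refine sum_congr rfl fun x _ => ?_
  apply S.ψ_congr
  simp only [Equiv.mulLeft₀_apply]
  rw [S.q_smul h3 h4, map_neg, h1]; ring

theorem tr_q_eq_zero {a b x : F} (ha : a ∈ S.K) (hx : x ∈ S.R a b) : S.tr (S.q a b x) = 0 := by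
  have h1 : S.tr (x * S.L a b x) = 2 * S.tr (S.q a b x) := by
    have h2 : S.tr (S.q a b (x + -x)) = 0 := by rw [add_neg_cancel, S.q_zero, map_zero]
    have h3 : S.q a b (-x) = S.q a b x := by simp only [q, map_neg]; ring
    rw [S.tr_q_add ha, h3, neg_mul, map_neg] at h2
    linear_combination -h2
  rw [S.mem_R.1 hx, mul_zero, map_zero] at h1
  have h2 : (2 : ZMod p) ≠ 0 := by
    intro h0
    obtain ⟨x, hx⟩ := S.tr_ne
    have h3 : S.tr (2 * (x / 2)) = 0 := by
      rw [two_mul, map_add, ← two_mul, h0, zero_mul]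
    rw [mul_div_cancel₀ _ S.two_ne] at h3
    exact hx h3
  simpa [h2] using h1.symm

theorem T_sq {a : F} (ha : a ∈ S.K) (b : F) : S.T a b ^ 2 = (S.P : ℂ) ^ 2 * #(S.R a b) := by
  have h1 : S.T a b ^ 2 = ∑ y, ∑ x, S.ψ (S.q a b (x + y)) * S.ψ (-S.q a b y) := by
    have h2 : ∀ y, ∑ x, S.ψ (S.q a b (x + y)) = S.T a b := fun y =>
      Equiv.sum_comp (Equiv.addRight y) fun x => S.ψ (S.q a b x)
    simp_rw [← sum_mul, h2, ← mul_sum, S.sum_ψ_neg, sq]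
  have h2 : ∀ x y, S.ψ (S.q a b (x + y)) * S.ψ (-S.q a b y)
      = S.ψ (S.q a b x) * S.ψ (y * S.L a b x) := by
    intro x y
    rw [← AddChar.map_add_eq_mul, ← AddChar.map_add_eq_mul]
    apply S.ψ_congr
    rw [map_add, map_add, map_neg, S.tr_q_add ha]; ring
  rw [h1, sum_comm]
  simp_rw [h2, ← mul_sum, S.sum_ψ, mul_ite, mul_zero]
  rw [← sum_filter]
  have h3 : ∀ x ∈ ({x | S.L a b x = 0} : Finset F),
      S.ψ (S.q a b x) * (S.P : ℂ) ^ 2 = (S.P : ℂ) ^ 2 := by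
    intro x hx
    rw [S.ψ_apply, S.tr_q_eq_zero ha hx, AddChar.map_zero_eq_one, one_mul]
  rw [sum_congr rfl h3, sum_const, nsmul_eq_mul, mul_comm]
  rfl

omit [Fact p.Prime] in
theorem card_K' : #S.K = S.P := S.card_K

omit [Fact p.Prime] in
theorem card_k' : #S.k = S.u := S.card_k

theorem sum_K_ψ {n : F} (hn : n ∈ S.K) :
    ∑ a ∈ S.K, S.ψ (a * n) = if n = 0 then (S.P : ℂ) else 0 := by
  split_ifs with h0
  · simp [h0, S.card_K']
  obtain ⟨x, hx⟩ := S.tr_ne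
  set c := (x + S.τ x) / (2 * n) with hc
  have hcK : c ∈ S.K := by
    rw [S.mem_K, hc]; simp only [map_div₀, map_add, map_mul, S.τ_τ, map_ofNat, S.mem_K.1 hn]
    ring
  have h1 : S.tr (c * n) = S.tr x := by
    have h2 : c * n = x / 2 + S.τ (x / 2) := by
      rw [hc]; simp only [map_div₀, map_ofNat]; field_simp [S.two_ne]
    rw [h2, map_add, S.tr_τ, ← map_add]
    congr 1; field_simp [S.two_ne]; norm_num
  have h2 : S.ψ (c * n) ≠ 1 := by
    rw [S.ψ_apply, h1]
    intro h
    exact hx (ZMod.injective_stdAddChar (by rw [h, AddChar.map_zero_eq_one]))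
  have h3 : ∑ a ∈ S.K, S.ψ (a * n) = S.ψ (c * n) * ∑ a ∈ S.K, S.ψ (a * n) := by
    rw [mul_sum]
    refine (sum_bij' (fun a _ => a + c) (fun a _ => a - c) ?_ ?_ ?_ ?_ ?_).symm
    · intro a ha; rw [S.mem_K] at *; rw [map_add, ha, hcK]
    · intro a ha; rw [S.mem_K] at *; rw [map_sub, ha, hcK]
    · intro a _; ring
    · intro a _; ring
    · intro a _; rw [add_mul, AddChar.map_add_eq_mul, mul_comm]
  have h4 : (S.ψ (c * n) - 1) * ∑ a ∈ S.K, S.ψ (a * n) = 0 := by linear_combination -h3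
  exact (mul_eq_zero.1 h4).resolve_left (sub_ne_zero.2 h2)

omit [Fact p.Prime] in
theorem norm_mem_K (x : F) : x * S.τ x ∈ S.K := by
  rw [S.mem_K, map_mul, S.τ_τ, mul_comm]

/-- The parameter `a` for which `1` lies in the radical. -/
def α (b : F) : F := -(b + S.σ.symm b)

omit [Fact p.Prime] in
theorem α_mem_K {b : F} (hb : b ∈ S.K) : S.α b ∈ S.K := by
  rw [S.mem_K] at *
  rw [α, map_neg, map_add, S.τ_symm, hb]

omit [Fact p.Prime] in
theorem L_one {a : F} (ha : a ∈ S.K) (b : F) :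
    S.L a b 1 = 0 ↔ b ∈ S.K ∧ a = S.α b := by
  simp only [L, α, map_one, mul_one]
  constructor
  · intro h
    refine ⟨?_, by linear_combination h⟩
    rw [S.mem_K] at *
    have h1 : a + S.τ b + S.σ.symm (S.τ b) = 0 := by
      rw [← S.τ_symm]
      nth_rw 1 [← ha]
      rw [← map_add, ← map_add, h, map_zero]
    have h2 : S.σ.symm (S.τ b - b) = -(S.τ b - b) := by
      rw [map_sub]; linear_combination h1 - h
    have h3 : S.τ b - b = 0 := by
      apply S.eq_zero_of_neg
      · have := congrArg S.σ h2
        rw [RingEquiv.apply_symm_apply, map_neg] at this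
        linear_combination this
      · rw [map_sub, S.τ_τ]; ring
    exact sub_eq_zero.1 h3
  · rintro ⟨_, rfl⟩; ring

omit [Fact p.Prime] in
theorem L_α {b : F} (hb : b ∈ S.K) (y : F) :
    y ∈ S.R (S.α b) b ↔ b * (S.σ y - S.τ y) ∈ S.k := by
  rw [S.mem_K] at hb
  set z := b * (S.σ y - S.τ y) with hz
  have h1 : S.L (S.α b) b y = z - S.σ.symm (S.τ z) := by
    have : S.τ z = b * (S.σ (S.τ y) - y) := by
      rw [hz, map_mul, map_sub, S.τ_τ, S.τ_σ, hb]
    rw [this, hz]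
    simp only [L, α, map_mul, map_sub, RingEquiv.symm_apply_apply]; ring
  rw [S.mem_R, h1, sub_eq_zero, S.mem_k, RingEquiv.eq_symm_apply]

theorem ψ_q_α {b : F} (hb : b ∈ S.K) (x : F) :
    S.ψ (S.q (S.α b) b x) =
      S.ψ (b * (-((S.σ x - S.τ x) * S.τ (S.σ x - S.τ x)) / 2)) := by
  apply S.ψ_congr
  rw [S.mem_K] at hb
  have h1 : S.tr (S.σ.symm b * (x * S.τ x) / 2) = S.tr (b * (S.σ x * S.σ (S.τ x)) / 2) := by
    rw [← S.tr_σ]; simp only [map_mul, map_div₀, map_ofNat, RingEquiv.apply_symm_apply]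
  have h2 : S.tr (b * (S.τ x * S.σ (S.τ x)) / 2) = S.tr (b * (x * S.σ x) / 2) := by
    rw [← S.tr_τ]; simp only [map_mul, map_div₀, map_ofNat, S.τ_σ, S.τ_τ, hb]
  have h3 : S.q (S.α b) b x = -(b * (x * S.τ x) / 2) - S.σ.symm b * (x * S.τ x) / 2
      + b * (x * S.σ x) / 2 + b * (x * S.σ x) / 2 := by
    simp only [q, α]; field_simp [S.two_ne]; ring
  have h4 : b * (-((S.σ x - S.τ x) * S.τ (S.σ x - S.τ x)) / 2) = -(b * (x * S.τ x) / 2)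
      - b * (S.σ x * S.σ (S.τ x)) / 2 + b * (x * S.σ x) / 2
      + b * (S.τ x * S.σ (S.τ x)) / 2 := by
    simp only [map_sub, S.τ_σ, S.τ_τ]; ring
  rw [h3, h4]
  simp only [map_add, map_sub, h1, h2]

theorem sum_T_α : ∑ b ∈ S.K, S.T (S.α b) b = S.P * S.u := by
  have h1 : ∑ b ∈ S.K, S.T (S.α b) b = ∑ b ∈ S.K, ∑ x,
      S.ψ (b * (-((S.σ x - S.τ x) * S.τ (S.σ x - S.τ x)) / 2)) :=
    sum_congr rfl fun b hb => sum_congr rfl fun x _ => S.ψ_q_α hb x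
  have h2 : ∀ w : F, -(w * S.τ w) / 2 ∈ S.K := by
    intro w
    rw [S.mem_K, map_div₀, map_neg, S.mem_K.1 (S.norm_mem_K w), map_ofNat]
  rw [h1, sum_comm]
  simp_rw [S.sum_K_ψ (h2 _)]
  rw [← sum_filter, sum_const, nsmul_eq_mul, mul_comm, ← S.card_k']
  congr 3
  ext x
  simp [mem_k, S.two_ne, sub_eq_zero]

theorem sum_T_zero : ∑ a ∈ S.K, S.T a 0 = S.P := by
  have h1 : ∀ a x, S.q a 0 x = a * (x * S.τ x / 2) := by
    intro a x; simp only [q]; ring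
  have h2 : ∀ w : F, w * S.τ w / 2 ∈ S.K := by
    intro w
    rw [S.mem_K, map_div₀, S.mem_K.1 (S.norm_mem_K w), map_ofNat]
  simp_rw [T, h1]
  rw [sum_comm]
  simp_rw [S.sum_K_ψ (h2 _)]
  rw [← sum_filter, sum_const, nsmul_eq_mul]
  have : ({x | x * S.τ x / 2 = 0} : Finset F) = {0} := by
    ext x; simp [S.two_ne]
  rw [this]; simp

theorem T_zero_zero : S.T 0 0 = (S.P : ℂ) ^ 2 := by
  simp [T, q, S.card_F]

omit [Fact p.Prime] in
theorem zero_mem_K : (0 : F) ∈ S.K := by simp [mem_K]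

omit [Fact p.Prime] in
theorem zero_mem_k : (0 : F) ∈ S.k := by simp [mem_k]

/-- The anisotropic plane form scaled by `a` has exponential sum `-P`. -/
theorem T_zero {a : F} (ha : a ∈ S.K) (h0 : a ≠ 0) : S.T a 0 = -S.P := by
  have hP : (S.P : ℂ) ≠ 0 := pow_ne_zero_iff two_ne_zero |>.1 S.card_F_ne
  have h1 : ∀ a ∈ S.K.erase 0, S.T a 0 = -S.P ∨ S.T a 0 = S.P := by
    intro a ha
    obtain ⟨h0, ha⟩ := mem_erase.1 ha
    have h2 : S.R a 0 = {0} := by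
      ext x; simp [mem_R, L, h0]
    have h3 := S.T_sq ha 0
    rw [h2, card_singleton, Nat.cast_one, mul_one] at h3
    exact (sq_eq_sq_iff_eq_or_eq_neg.1 h3).symm
  have h2 : ∑ a ∈ S.K.erase 0, (S.T a 0 + S.P) = 0 := by
    have h3 := S.sum_T_zero
    rw [← sum_erase_add _ _ S.zero_mem_K, S.T_zero_zero] at h3
    rw [sum_add_distrib, sum_const, card_erase_of_mem S.zero_mem_K, S.card_K', nsmul_eq_mul,
      Nat.cast_sub S.one_lt_P.le, Nat.cast_one]
    linear_combination h3
  have h3 : ∀ a ∈ S.K.erase 0, S.T a 0 + S.P = if S.T a 0 = S.P then 2 * (S.P : ℂ) else 0 := by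
    intro a ha
    rcases h1 a ha with h | h
    · rw [h, if_neg]
      · ring
      · intro h'; apply hP; linear_combination -h' / 2
    · rw [h, if_pos rfl]; ring
  rw [sum_congr rfl h3, ← sum_filter, sum_const, nsmul_eq_mul, mul_eq_zero, Nat.cast_eq_zero,
    card_eq_zero, filter_eq_empty_iff] at h2
  have h4 := (h2.resolve_right (by simp [hP])) (mem_erase.2 ⟨h0, ha⟩)
  exact (h1 a (mem_erase.2 ⟨h0, ha⟩)).resolve_right h4

/-- When `1` lies in the radical and the radical is larger than `k`, the sum is `-P * u`. -/
theorem T_α_of_not_mem {b y : F} (hb : b ∈ S.K) (h0 : b ≠ 0) (hy : y ∈ S.R (S.α b) b)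
    (hyk : y ∉ S.k) : S.T (S.α b) b = -(S.P * S.u) := by
  have hbK := S.mem_K.1 hb
  rw [S.L_α hb] at hy
  set c := b * (S.σ y - S.τ y) with hc
  have hc0 : c ≠ 0 := mul_ne_zero h0 (sub_ne_zero.2 fun h => hyk (S.mem_k.2 h))
  have hadj : ∀ x z, S.tr (z * (S.σ x - S.τ x)) = S.tr (x * (S.σ.symm z - S.τ z)) := by
    intro x z
    rw [mul_sub, mul_sub, map_sub, map_sub]
    congr 1
    · rw [← S.tr_symm, map_mul, RingEquiv.symm_apply_apply, mul_comm]
    · rw [← S.tr_τ, map_mul, S.τ_τ, mul_comm]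
  have hker : ∀ z, S.σ.symm z - S.τ z = 0 ↔ z ∈ S.k := by
    intro z
    rw [sub_eq_zero, RingEquiv.symm_apply_eq, S.mem_k]
    constructor
    · intro h; nth_rw 2 [h]; rw [S.τ_σ, S.τ_τ]
    · intro h; rw [← S.τ_σ, h, S.τ_τ]
  have h1 : S.T (S.α b) b = ∑ w, #{x | S.σ x - S.τ x = w} * S.ψ (b * (-(w * S.τ w) / 2)) := by
    rw [T, sum_congr rfl fun x _ => S.ψ_q_α hb x, ← sum_fiberwise univ fun x => S.σ x - S.τ x]
    refine sum_congr rfl fun w _ => ?_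
    rw [← nsmul_eq_mul, ← sum_const]
    exact sum_congr rfl fun x hx => by rw [(mem_filter.1 hx).2]
  have h2 : ∀ w z, z ∈ S.k → S.ψ (-(z * w)) * S.ψ (b * (-(w * S.τ w) / 2))
      = S.ψ (S.q (-b) 0 (w + z / b)) := by
    intro w z hz
    have hzK := S.mem_K.1 (S.mem_K_of_mem_k hz)
    rw [← AddChar.map_add_eq_mul]
    apply S.ψ_congr
    have h3 : S.tr (z ^ 2 / b / 2) = 0 := by
      set e := z ^ 2 / (2 * c) with he
      have hek : S.σ e = e ∧ S.τ e = e := by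
        simp only [he, map_div₀, map_mul, map_pow, map_ofNat, (S.mem_k_iff.1 hz).1,
          (S.mem_k_iff.1 hz).2, (S.mem_k_iff.1 hy).1, (S.mem_k_iff.1 hy).2, and_self]
      have h4 : z ^ 2 / b / 2 = S.σ (e * y) - S.τ (e * y) := by
        rw [map_mul, map_mul, hek.1, hek.2, ← mul_sub, he]
        have : S.σ y - S.τ y = c / b := by rw [hc]; field_simp
        rw [this]; field_simp [S.two_ne]
      rw [h4, map_sub, S.tr_σ, S.tr_τ, sub_self]
    have h4 : S.tr (z * w / 2) = S.tr (z * S.τ w / 2) := by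
      rw [← S.tr_τ]; simp only [map_mul, map_div₀, map_ofNat, hzK]
    have h5 : S.q (-b) 0 (w + z / b) = b * (-(w * S.τ w) / 2) - z * w / 2 - z * S.τ w / 2
        - z ^ 2 / b / 2 := by
      simp only [q, map_add, map_div₀, hzK, hbK]; field_simp [S.two_ne]; ring
    have h6 : -(z * w) = -(z * w / 2) - z * w / 2 := by field_simp [S.two_ne]; ring
    rw [h5, h6]
    simp only [map_add, map_sub, map_neg, h3, ← h4]; ring
  have h3 : ∀ w, (#{x | S.σ x - S.τ x = w} : ℂ) = ∑ z ∈ S.k, S.ψ (-(z * w)) := by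
    intro w
    rw [S.card_fiber hadj]
    exact sum_congr (by ext z; simp [hker]) fun _ _ => rfl
  rw [h1]
  simp_rw [h3, sum_mul]
  rw [sum_comm]
  have h4 : ∀ z ∈ S.k, ∑ w, S.ψ (-(z * w)) * S.ψ (b * (-(w * S.τ w) / 2)) = -S.P := by
    intro z hz
    rw [sum_congr rfl fun w _ => h2 w z hz]
    exact (Equiv.sum_comp (Equiv.addRight (z / b)) fun w => S.ψ (S.q (-b) 0 w)).trans
      (S.T_zero (by rw [S.mem_K, map_neg, hbK]) (neg_ne_zero.2 h0))
  rw [sum_congr rfl h4, sum_const, S.card_k', nsmul_eq_mul]; ring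

omit [Fact p.Prime] in
theorem k_subset_R_α {b : F} (hb : b ∈ S.K) : S.k ⊆ S.R (S.α b) b := by
  intro y hy
  rw [S.L_α hb, S.mem_k.1 hy, sub_self, mul_zero]
  exact S.zero_mem_k

omit [Fact p.Prime] in
theorem card_R_α_of_not_mem {b y : F} (hb : b ∈ S.K) (h0 : b ≠ 0) (hy : y ∈ S.R (S.α b) b)
    (hyk : y ∉ S.k) : #(S.R (S.α b) b) = S.u ^ 2 := by
  have hy' := (S.L_α hb y).1 hy
  set c := b * (S.σ y - S.τ y) with hc
  have hc0 : c ≠ 0 := mul_ne_zero h0 (sub_ne_zero.2 fun h => hyk (S.mem_k.2 h))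
  rw [sq, ← S.card_k', ← card_product]
  have key : ∀ z ∈ S.k ×ˢ S.k,
      b * (S.σ (z.1 + z.2 * y) - S.τ (z.1 + z.2 * y)) = z.2 * c := by
    intro z hz
    obtain ⟨h1, h2⟩ := mem_product.1 hz
    simp only [map_add, map_mul, (S.mem_k_iff.1 h1).1, (S.mem_k_iff.1 h1).2,
      (S.mem_k_iff.1 h2).1, (S.mem_k_iff.1 h2).2, hc]
    ring
  symm
  refine card_bij (fun z _ => z.1 + z.2 * y) ?_ ?_ ?_
  · intro z hz
    rw [S.L_α hb, key z hz, S.mem_k, map_mul S.σ z.2 c, map_mul S.τ z.2 c, S.mem_k.1 hy',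
      S.mem_k.1 (mem_product.1 hz).2]
  · intro z hz z' hz' h
    have h1 : z.2 * c = z'.2 * c := by rw [← key z hz, ← key z' hz', h]
    have h2 := mul_right_cancel₀ hc0 h1
    rw [h2] at h
    exact Prod.ext (add_right_cancel h) h2
  · intro x hx
    have hx' := (S.L_α hb x).1 hx
    set e := b * (S.σ x - S.τ x) / c with he
    have hek : S.σ e = e ∧ S.τ e = e := by
      rw [S.mem_k_iff] at hx' hy'
      constructor
      · rw [he, map_div₀, hx'.1, hy'.1]
      · rw [he, map_div₀, hx'.2, hy'.2]
    refine ⟨(x - e * y, e), mem_product.2 ⟨?_, S.mem_k_iff.2 hek⟩, by ring⟩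
    have h1 : b * (S.σ x - S.τ x) = e * c := by rw [he, div_mul_cancel₀ _ hc0]
    rw [S.mem_k]
    simp only [map_sub, map_mul, hek.1, hek.2]
    apply mul_left_cancel₀ h0
    rw [hc] at h1
    linear_combination h1

theorem R_α_cases {b : F} (hb : b ∈ S.K) (h0 : b ≠ 0) :
    #(S.R (S.α b) b) = S.u ∨ (#(S.R (S.α b) b) = S.u ^ 2 ∧ S.T (S.α b) b = -(S.P * S.u)) := by
  by_cases h : S.R (S.α b) b ⊆ S.k
  · left; rw [(h.antisymm (S.k_subset_R_α hb)), S.card_k']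
  · right
    obtain ⟨y, hy, hyk⟩ := not_subset.1 h
    exact ⟨S.card_R_α_of_not_mem hb h0 hy hyk, S.T_α_of_not_mem hb h0 hy hyk⟩

omit [Fact p.Prime] in
theorem k_subset_K : S.k ⊆ S.K := fun _ => S.mem_K_of_mem_k

omit [Fact p.Prime] in
theorem card_filter_K {y : F} : (y ∈ S.k → #{b ∈ S.K | b * (S.σ y - S.τ y) ∈ S.k} = S.P) ∧
    (y ∈ S.K \ S.k → #{b ∈ S.K | b * (S.σ y - S.τ y) ∈ S.k} = S.u) ∧
    (y ∈ univ \ S.K → #{b ∈ S.K | b * (S.σ y - S.τ y) ∈ S.k} = 1) := by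
  set w := S.σ y - S.τ y with hw
  have hw0 : w = 0 ↔ y ∈ S.k := by rw [hw, sub_eq_zero, S.mem_k]
  have hwK : S.τ w = w ↔ y ∈ S.K := by
    rw [S.mem_K, hw, map_sub, S.τ_σ, S.τ_τ]
    constructor
    · intro h
      refine (sub_eq_zero.1 (S.eq_zero_of_neg (S.τ y - y) ?_ ?_))
      · rw [map_sub]; linear_combination h
      · rw [map_sub, S.τ_τ]; ring
    · intro h; rw [h]
  refine ⟨fun h => ?_, fun h => ?_, fun h => ?_⟩
  · rw [hw0.2 h, ← S.card_K', filter_true_of_mem]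
    intro b _; rw [mul_zero]; exact S.zero_mem_k
  · obtain ⟨h1, h2⟩ := mem_sdiff.1 h
    have h3 : w ≠ 0 := fun h => h2 (hw0.1 h)
    rw [← S.card_k']
    refine card_bij (fun b _ => b * w) (fun b hb => (mem_filter.1 hb).2)
      (fun b _ b' _ h => mul_right_cancel₀ h3 h) fun z hz => ⟨z / w, ?_, div_mul_cancel₀ _ h3⟩
    rw [mem_filter, div_mul_cancel₀ _ h3, S.mem_K, map_div₀, (hwK.2 h1),
      (S.mem_k_iff.1 hz).2]
    exact ⟨rfl, hz⟩
  · have h1 : ¬ S.τ w = w := fun h' => (mem_sdiff.1 h).2 (hwK.1 h')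
    rw [card_eq_one]
    refine ⟨0, ?_⟩
    ext b
    rw [mem_filter, mem_singleton]
    constructor
    · rintro ⟨hb, hbw⟩
      by_contra h0
      have h2 := (S.mem_k_iff.1 hbw).2
      rw [map_mul, S.mem_K.1 hb] at h2
      exact h1 (mul_left_cancel₀ h0 h2)
    · rintro rfl; rw [zero_mul]; exact ⟨S.zero_mem_K, S.zero_mem_k⟩

omit [Fact p.Prime] in
theorem sum_card_R_α : (∑ b ∈ S.K, #(S.R (S.α b) b) : ℂ)
    = S.u * S.P + (S.P - S.u) * S.u + (S.P ^ 2 - S.P) := by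
  have h1 : ∑ b ∈ S.K, #(S.R (S.α b) b) = ∑ y, #{b ∈ S.K | b * (S.σ y - S.τ y) ∈ S.k} := by
    rw [sum_congr rfl fun b hb => congrArg card (show S.R (S.α b) b
      = ({y | b * (S.σ y - S.τ y) ∈ S.k} : Finset F) by ext y; rw [S.L_α hb]; simp)]
    simp_rw [card_filter]
    exact sum_comm
  have hu : S.u ≤ S.P := by
    rw [← S.card_k', ← S.card_K']; exact card_le_card S.k_subset_K
  have h2 : ∑ b ∈ S.K, #(S.R (S.α b) b) = S.u * S.P + (S.P - S.u) * S.u + (S.P ^ 2 - S.P) := by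
    rw [h1, ← sum_sdiff (subset_univ S.K), ← sum_sdiff S.k_subset_K,
      sum_congr rfl fun y hy => (S.card_filter_K (y := y)).2.2 hy,
      sum_congr rfl fun y hy => (S.card_filter_K (y := y)).2.1 hy,
      sum_congr rfl fun y hy => (S.card_filter_K (y := y)).1 hy]
    simp only [sum_const, smul_eq_mul, card_sdiff_of_subset S.k_subset_K,
      card_sdiff_of_subset (subset_univ S.K), S.card_k', S.card_K', card_univ, S.card_F]
    ring
  rw [← Nat.cast_sum, h2]
  push_cast [Nat.cast_sub hu, Nat.cast_sub (Nat.le_self_pow two_ne_zero S.P)]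
  rfl

theorem T_scale (a b : F) {c : F} (hc : c ≠ 0) :
    S.T (a * (c * S.τ c)) (b * (c * S.σ c)) = S.T a b := by
  simp_rw [T, ← S.q_mul]
  exact Equiv.sum_comp (Equiv.mulLeft₀ c hc) fun x => S.ψ (S.q a b x)

omit [Fact p.Prime] in
theorem card_R_scale (a b : F) {c : F} (hc : c ≠ 0) :
    #(S.R (a * (c * S.τ c)) (b * (c * S.σ c))) = #(S.R a b) := by
  refine card_nbij' (fun x => c * x) (fun x => x / c) ?_ ?_ ?_ ?_
  · intro x hx
    simpa [mem_R, L_scale, hc] using hx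
  · intro x hx
    simpa [mem_R, L_scale, hc, mul_div_cancel₀ x hc] using hx
  · intro x _; exact mul_div_cancel_left₀ x hc
  · intro x _; exact mul_div_cancel₀ x hc

omit [Fact p.Prime] in
theorem zero_mem_R (a b : F) : 0 ∈ S.R a b := by simp [mem_R, L]

theorem R_cases {a b : F} (ha : a ∈ S.K) (h0 : (a, b) ≠ (0, 0)) : #(S.R a b) = 1 ∨
    #(S.R a b) = S.u ∨ (#(S.R a b) = S.u ^ 2 ∧ S.T a b = -(S.P * S.u)) := by
  by_cases h : S.R a b ⊆ {0}
  · left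
    rw [h.antisymm (singleton_subset_iff.2 (S.zero_mem_R a b)), card_singleton]
  right
  obtain ⟨x, hx, hx0⟩ := not_subset.1 h
  rw [mem_singleton] at hx0
  have h1 := S.L_scale a b x 1
  rw [mul_one, S.mem_R.1 hx, mul_zero, S.L_one] at h1
  · obtain ⟨h2, h3⟩ := h1
    rw [← S.card_R_scale a b hx0, ← S.T_scale a b hx0, h3]
    refine S.R_α_cases h2 fun h4 => h0 ?_
    rw [h4] at h3
    simpa [α, hx0] using And.intro h3 h4
  · have := S.mem_K.1 (S.norm_mem_K x)
    rw [S.mem_K] at *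
    rw [map_mul, this, ha]

omit [Fact p.Prime] in
theorem sum_mul_card_R_sub_one {g : F → F → ℂ}
    (hg : ∀ a b c, c ≠ 0 → g (a * (c * S.τ c)) (b * (c * S.σ c)) = g a b) :
    ∑ t ∈ S.K ×ˢ univ, g t.1 t.2 * (#(S.R t.1 t.2) - 1)
      = (S.P ^ 2 - 1) * ∑ b ∈ S.K, g (S.α b) b := by
  have h1 : ∀ t ∈ S.K ×ˢ (univ : Finset F), g t.1 t.2 * (#(S.R t.1 t.2) - 1)
      = ∑ x ∈ univ.erase 0, if S.L t.1 t.2 x = 0 then g t.1 t.2 else 0 := by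
    intro t _
    have h2 : S.R t.1 t.2 = insert 0 ({x ∈ univ.erase 0 | S.L t.1 t.2 x = 0} : Finset F) := by
      ext x
      by_cases hx : x = 0
      · simp [hx, S.zero_mem_R]
      · simp [hx, mem_R]
    rw [h2, card_insert_of_notMem (by simp), ← sum_filter, sum_const, nsmul_eq_mul]
    push_cast; ring
  have h3 : ∀ x ∈ univ.erase (0 : F), ∑ t ∈ S.K ×ˢ (univ : Finset F),
      (if S.L t.1 t.2 x = 0 then g t.1 t.2 else 0) = ∑ b ∈ S.K, g (S.α b) b := by
    intro x hx
    have hx0 := (mem_erase.1 hx).1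
    have hσ : x * S.σ x ≠ 0 := by simp [hx0]
    have hτ : x * S.τ x ≠ 0 := by simp [hx0]
    have h4 : ∀ a, a * (x * S.τ x) ∈ S.K ↔ a ∈ S.K := by
      intro a
      rw [S.mem_K, S.mem_K, map_mul, S.mem_K.1 (S.norm_mem_K x)]
      exact mul_left_inj' hτ
    rw [← sum_filter]
    have h5 : ∀ t ∈ S.K ×ˢ (univ : Finset F), S.L t.1 t.2 x = 0 →
        t.2 * (x * S.σ x) ∈ S.K ∧ t.1 * (x * S.τ x) = S.α (t.2 * (x * S.σ x)) := by
      intro t ht h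
      rw [← S.L_one ((h4 _).2 (mem_product.1 ht).1), L_scale, mul_one, h, mul_zero]
    refine sum_bij' (fun t _ => t.2 * (x * S.σ x))
      (fun b _ => (S.α b / (x * S.τ x), b / (x * S.σ x))) ?_ ?_ ?_ ?_ ?_
    · intro t ht
      obtain ⟨h6, h7⟩ := mem_filter.1 ht
      exact (h5 t h6 h7).1
    · intro b hb
      have h6 : S.α b / (x * S.τ x) ∈ S.K := by
        rw [← h4, div_mul_cancel₀ _ hτ]; exact S.α_mem_K hb
      refine mem_filter.2 ⟨mem_product.2 ⟨h6, mem_univ _⟩, ?_⟩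
      have h7 := S.L_scale (S.α b / (x * S.τ x)) (b / (x * S.σ x)) x 1
      rw [div_mul_cancel₀ _ hτ, div_mul_cancel₀ _ hσ, mul_one,
        (S.L_one (S.α_mem_K hb) b).2 ⟨hb, rfl⟩] at h7
      exact (mul_eq_zero.1 h7.symm).resolve_left hx0
    · intro t ht
      obtain ⟨h6, h7⟩ := mem_filter.1 ht
      have h8 := (h5 t h6 h7).2
      refine Prod.ext ?_ (mul_div_cancel_right₀ _ hσ)
      change S.α (t.2 * (x * S.σ x)) / (x * S.τ x) = t.1
      rw [← h8, mul_div_cancel_right₀ _ hτ]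
    · intro b _; exact div_mul_cancel₀ _ hσ
    · intro t ht
      obtain ⟨h6, h7⟩ := mem_filter.1 ht
      rw [← (h5 t h6 h7).2, hg _ _ _ hx0]
  rw [sum_congr rfl h1, sum_comm, sum_congr rfl h3, sum_const, card_erase_of_mem (mem_univ _),
    card_univ, S.card_F, nsmul_eq_mul, Nat.cast_sub (Nat.one_le_pow _ _ (by have := S.one_lt_P; omega))]
  push_cast; rfl

theorem sum_T : ∑ t ∈ S.K ×ˢ (univ : Finset F), S.T t.1 t.2 = (S.P : ℂ) ^ 3 := by
  rw [sum_product]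
  have h1 : ∀ a ∈ S.K, ∑ b, S.T a b = (S.P : ℂ) ^ 2 := by
    intro a _
    simp_rw [T]
    rw [sum_comm]
    have h2 : ∀ x, ∑ b, S.ψ (S.q a b x) = if x = 0 then (S.P : ℂ) ^ 2 else 0 := by
      intro x
      simp_rw [q, AddChar.map_add_eq_mul, ← mul_sum, S.sum_ψ]
      by_cases hx : x = 0
      · simp [hx]
      · simp [hx]
    simp_rw [h2]
    simp
  rw [sum_congr rfl h1, sum_const, S.card_K', nsmul_eq_mul]; ring

/-- The number of forms of full rank whose exponential sum is `P`. -/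
theorem card_T_eq : (#{t ∈ S.K ×ˢ (univ : Finset F) | S.T t.1 t.2 = S.P} : ℂ)
      * (2 * (S.u + 1)) = S.u * (S.P + 1) * (S.P ^ 2 - 1) := by
  have hP : (S.P : ℂ) ≠ 0 := pow_ne_zero_iff two_ne_zero |>.1 S.card_F_ne
  have hP1 : (S.P : ℂ) ≠ 1 := by have := S.one_lt_P; exact_mod_cast this.ne'
  have hu1 : (1 - S.u : ℂ) ≠ 0 := by
    have := S.one_lt_u
    rw [sub_ne_zero]; exact_mod_cast this.ne
  set r : F × F → ℂ := fun t => #(S.R t.1 t.2) with hr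
  set v : F × F → ℂ := fun t => S.T t.1 t.2 with hv
  set W := S.K ×ˢ (univ : Finset F) with hW
  have m0 : ∑ t ∈ W, (1 : ℂ) = S.P ^ 3 := by
    rw [sum_const, card_product, S.card_K', card_univ, S.card_F, nsmul_eq_mul]
    push_cast; ring
  have m1 : ∑ t ∈ W, v t = S.P ^ 3 := S.sum_T
  have m2 : ∑ t ∈ W, (r t - 1) = (S.P ^ 2 - 1) * S.P := by
    have h := S.sum_mul_card_R_sub_one (g := fun _ _ => 1) fun _ _ _ _ => rfl
    simp only [one_mul, sum_const, S.card_K', nsmul_eq_mul, mul_one] at h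
    exact h
  have m3 : ∑ t ∈ W, v t * (r t - 1) = (S.P ^ 2 - 1) * (S.P * S.u) := by
    have h := S.sum_mul_card_R_sub_one (g := S.T) fun a b c hc => S.T_scale a b hc
    rw [S.sum_T_α] at h
    exact h
  have m4 : ∑ t ∈ W, (r t - 1) * (r t - 1) = (S.P ^ 2 - 1) * (S.u * S.P + (S.P - S.u) * S.u
      + (S.P ^ 2 - S.P) - S.P) := by
    have h := S.sum_mul_card_R_sub_one (g := fun a b => #(S.R a b) - 1)
      fun a b c hc => by rw [S.card_R_scale a b hc]
    rw [sum_sub_distrib, S.sum_card_R_α, sum_const, S.card_K', nsmul_eq_mul, mul_one] at h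
    exact h
  have h0 : ((0, 0) : F × F) ∈ W := mem_product.2 ⟨S.zero_mem_K, mem_univ _⟩
  have hv0 : v (0, 0) = S.P ^ 2 := S.T_zero_zero
  have hr0 : r (0, 0) = S.P ^ 2 := by
    simp only [hr]
    rw [show S.R (0 : F) 0 = univ by ext x; simp [mem_R, L], card_univ, S.card_F]
    push_cast; rfl
  have key : ∀ t ∈ W.erase (0, 0), (r t - 1) * (r t - 1) + 2 * (r t - 1)
      + (1 + S.u) / S.P * (v t * (r t - 1)) + (1 - S.u ^ 2) * 1 + (1 - S.u ^ 2) / S.P * v t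
      = if v t = S.P then 2 * (1 - (S.u : ℂ) ^ 2) else 0 := by
    intro t ht
    obtain ⟨ht0, ht⟩ := mem_erase.1 ht
    have hsq : v t ^ 2 = S.P ^ 2 * r t := S.T_sq (mem_product.1 ht).1 t.2
    have hfac : (r t - 1) * (r t - 1) + 2 * (r t - 1)
      + (1 + S.u) / S.P * (v t * (r t - 1)) + (1 - S.u ^ 2) * 1 + (1 - S.u ^ 2) / S.P * v t
      = (v t + S.P) * (v t + S.P * S.u) * (r t - S.u) / S.P ^ 2 := by
      field_simp
      linear_combination (S.u - r t) * hsq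
    rw [hfac]
    rcases S.R_cases (mem_product.1 ht).1 ht0 with h | h | ⟨h, h'⟩
    · have hr1 : r t = 1 := by simp only [hr, h, Nat.cast_one]
      rw [hr1, mul_one] at hsq
      rcases sq_eq_sq_iff_eq_or_eq_neg.1 hsq with h2 | h2
      · rw [if_pos h2, h2, hr1]; field_simp; ring
      · rw [if_neg, h2]
        · ring
        · intro h3; apply hP; linear_combination (h2 - h3) / 2
    · have hr1 : r t = S.u := by simp only [hr, h]
      rw [if_neg, hr1]
      · ring
      · intro h3
        rw [h3, hr1] at hsq
        apply hu1
        apply mul_left_cancel₀ S.card_F_ne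
        linear_combination hsq
    · have hv1 : v t = -(S.P * S.u) := h'
      rw [if_neg, hv1]
      · ring
      · intro h3
        rw [hv1] at h3
        have h4 : (S.u : ℂ) + 1 = 0 := by
          apply mul_left_cancel₀ hP
          linear_combination -h3
        exact Nat.cast_add_one_ne_zero S.u h4
  have hfilter : #{t ∈ W | v t = S.P} = #{t ∈ W.erase (0, 0) | v t = S.P} := by
    congr 1
    ext t
    simp only [mem_filter, mem_erase]
    refine ⟨fun h => ⟨⟨?_, h.1⟩, h.2⟩, fun h => ⟨h.1.2, h.2⟩⟩
    rintro rfl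
    rw [hv0] at h
    apply hP1
    apply mul_left_cancel₀ hP
    linear_combination h.2
  have hsum := sum_congr rfl key
  rw [← sum_filter, sum_const, nsmul_eq_mul, ← hfilter, ← add_right_cancel_iff, sum_erase_add _ _ h0]
    at hsum
  simp only [sum_add_distrib, ← mul_sum, m0, m1, m2, m3, m4, hr0, hv0] at hsum
  change (#{t ∈ W | v t = S.P} : ℂ) * _ = _
  apply mul_left_cancel₀ hu1
  field_simp at hsum
  linear_combination -hsum

theorem card_level {a b : F} :
    (p * #{x | S.tr (S.q a b x) = 0} : ℂ) = S.P ^ 2 + (p - 1) * S.T a b ∧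
    ∀ t ≠ 0, (p * #{x | S.tr (S.q a b x) = t} : ℂ) = S.P ^ 2 - S.T a b := by
  set n : ZMod p → ℂ := fun t => #{x | S.tr (S.q a b x) = t} with hn
  have h1 : ∀ t ∈ univ.erase (0 : ZMod p), n t = n 1 := by
    intro t ht
    obtain ⟨i, hi, hi0, h2, h3⟩ := S.exists_sq t (mem_erase.1 ht).1
    simp only [hn]
    congr 1
    symm
    have h4 : ∀ x, S.tr (S.q a b (i * x)) = t * S.tr (S.q a b x) := by
      intro x; rw [S.q_smul h2 h3, hi]
    refine card_nbij' (fun x => i * x) (fun x => x / i) ?_ ?_ ?_ ?_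
    · intro x hx
      simp only [coe_filter, mem_univ, true_and, Set.mem_ofPred_eq] at hx ⊢
      rw [h4, hx, mul_one]
    · intro x hx
      simp only [coe_filter, mem_univ, true_and, Set.mem_ofPred_eq] at hx ⊢
      apply mul_left_cancel₀ (mem_erase.1 ht).1
      rw [← h4, mul_div_cancel₀ _ hi0, hx, mul_one]
    · intro x _; exact mul_div_cancel_left₀ x hi0
    · intro x _; exact mul_div_cancel₀ x hi0
  have hp : 1 ≤ p := (Fact.out : p.Prime).one_lt.le
  have h2 : n 0 + (p - 1) * n 1 = S.P ^ 2 := by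
    have h3 : ∑ t, n t = S.P ^ 2 := by
      simp only [hn]
      rw [← Nat.cast_sum, sum_card_fiberwise_eq_card_filter]
      simp [S.card_F]
    rw [← sum_erase_add _ _ (mem_univ (0 : ZMod p)), sum_congr rfl h1, sum_const,
      card_erase_of_mem (mem_univ _), card_univ, ZMod.card, nsmul_eq_mul, Nat.cast_sub hp] at h3
    push_cast at h3
    linear_combination h3
  have h3 : S.T a b = n 0 - n 1 := by
    have h4 : S.T a b = ∑ t, n t * ZMod.stdAddChar t := by
      rw [T, ← sum_fiberwise univ fun x => S.tr (S.q a b x)]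
      refine sum_congr rfl fun t _ => ?_
      rw [← nsmul_eq_mul, ← sum_const]
      exact sum_congr rfl fun x hx => by rw [ψ_apply, (mem_filter.1 hx).2]
    have h5 : ∑ t : ZMod p, (ZMod.stdAddChar t : ℂ) = 0 := by
      have h6 := AddChar.sum_mulShift (1 : ZMod p) (ZMod.isPrimitive_stdAddChar p)
      simpa using h6
    rw [← sum_erase_add _ _ (mem_univ (0 : ZMod p)), AddChar.map_zero_eq_one] at h4 h5
    rw [h4, sum_congr rfl fun t ht => by rw [h1 t ht], ← mul_sum]
    linear_combination n 1 * h5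
  refine ⟨?_, fun t ht => ?_⟩
  · change (p : ℂ) * n 0 = _
    rw [h3]; linear_combination h2
  · change (p : ℂ) * n t = _
    rw [h1 t (mem_erase.2 ⟨ht, mem_univ _⟩), h3]; linear_combination h2

/-- The number of zeros of the inhomogeneous quadratic function `tr (q a b x + c * x) + h`. -/
def Z (a b c : F) (h : ZMod p) : ℕ := #{x | S.tr (S.q a b x + c * x) + h = 0}

theorem Z_L {a : F} (ha : a ∈ S.K) (b y : F) (h : ZMod p) :
    S.Z a b (S.L a b y) h = #{x | S.tr (S.q a b x) = S.tr (S.q a b y) - h} := by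
  have h1 : ∀ x, S.tr (S.q a b x + S.L a b y * x) + h
      = S.tr (S.q a b (y + x)) - (S.tr (S.q a b y) - h) := by
    intro x
    rw [S.tr_q_add ha, map_add, mul_comm]; ring
  rw [Z]
  simp_rw [h1, sub_eq_zero]
  exact card_nbij' (fun x => y + x) (fun x => x - y) (fun x hx => by simpa using hx)
    (fun x hx => by simpa using hx) (fun x _ => by ring) (fun x _ => by ring)

theorem Z_of_tr_ne {a z : F} (ha : a ∈ S.K) {b c : F} (hz : z ∈ S.R a b) (hc : S.tr (z * c) ≠ 0)
    (h : ZMod p) : (p * S.Z a b c h : ℂ) = S.P ^ 2 := by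
  have h1 : ∀ t, #{x | S.tr (S.q a b x + c * x) = t} = #{x | S.tr (S.q a b x + c * x) = -h} := by
    intro t
    set n : ℕ := ((-h - t) / S.tr (z * c)).val with hn
    have hnt : (n : ZMod p) * S.tr (z * c) = -h - t := by
      rw [hn, ZMod.natCast_val, ZMod.cast_id', id, div_mul_cancel₀ _ hc]
    have hnz : n * z ∈ S.R a b := by
      rw [S.mem_R] at *
      have : S.L a b (n * z) = n * S.L a b z := by
        simp only [L, map_mul, map_natCast]; ring
      rw [this, hz, mul_zero]
    have h2 : ∀ x, S.tr (S.q a b (n * z + x) + c * (n * z + x))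
        = S.tr (S.q a b x + c * x) + (-h - t) := by
      intro x
      have h3 : c * (n * z + x) = c * x + n • (z * c) := by rw [nsmul_eq_mul]; ring
      rw [map_add, S.tr_q_add ha, S.tr_q_eq_zero ha hnz, S.mem_R.1 hnz, mul_zero, map_zero, h3,
        map_add, map_add, map_nsmul, nsmul_eq_mul, hnt]
      ring
    refine card_nbij' (fun x => n * z + x) (fun x => x - n * z) ?_ ?_ ?_ ?_
    · intro x hx
      simp only [coe_filter, mem_univ, true_and, Set.mem_ofPred_eq] at hx ⊢
      rw [h2, hx]; ring
    · intro x hx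
      simp only [coe_filter, mem_univ, true_and, Set.mem_ofPred_eq] at hx ⊢
      have h3 := h2 (x - n * z)
      rw [add_sub_cancel, hx] at h3
      linear_combination -h3
    · intro x _; ring
    · intro x _; ring
  have h2 : ∑ t, #{x | S.tr (S.q a b x + c * x) = t} = S.P ^ 2 := by
    rw [sum_card_fiberwise_eq_card_filter]
    simp [S.card_F]
  rw [sum_congr rfl fun t _ => h1 t, sum_const, card_univ, ZMod.card, smul_eq_mul] at h2
  simp_rw [Z, add_eq_zero_iff_eq_neg]
  exact_mod_cast h2

theorem exists_L_eq_or {a : F} (ha : a ∈ S.K) (b c : F) :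
    (∃ y, S.L a b y = c) ∨ ∃ z ∈ S.R a b, S.tr (z * c) ≠ 0 := by
  by_contra! hcon
  have h1 := S.card_fiber (S.tr_L_symm ha b) c
  rw [filter_false_of_mem fun x _ => hcon.1 x] at h1
  have h2 : ∀ z ∈ ({z | S.L a b z = 0} : Finset F), S.ψ (-(z * c)) = 1 := by
    intro z hz
    rw [ψ_apply, map_neg, hcon.2 z hz, neg_zero, AddChar.map_zero_eq_one]
  rw [sum_congr rfl h2, sum_const, card_empty, nsmul_eq_mul, mul_one, eq_comm, Nat.cast_inj,
    card_eq_zero] at h1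
  have h3 := S.zero_mem_R a b
  rw [R, h1] at h3
  exact notMem_empty _ h3

/-- For fixed `a` and `b`, the number of `c` and `h` for which the number of zeros is
`(P ^ 2 + (p - 1) * P) / p`. -/
theorem card_Z_eq {a : F} (ha : a ∈ S.K) (b : F) :
    #{t : F × ZMod p | p * S.Z a b t.1 t.2 = S.P ^ 2 + (p - 1) * S.P}
      = if S.T a b = S.P then S.P ^ 2 else 0 := by
  have hp := (Fact.out : p.Prime).one_lt
  have hP : (S.P : ℂ) ≠ 0 := pow_ne_zero_iff two_ne_zero |>.1 S.card_F_ne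
  have hp0 : (p : ℂ) ≠ 0 := by exact_mod_cast (Fact.out : p.Prime).ne_zero
  have hp1 : (p - 1 : ℂ) ≠ 0 := by rw [sub_ne_zero]; exact_mod_cast hp.ne'
  have hcast : ∀ n : ℕ, p * n = S.P ^ 2 + (p - 1) * S.P ↔
      (p * n : ℂ) = S.P ^ 2 + (p - 1) * S.P := by
    intro n
    rw [← Nat.cast_inj (R := ℂ)]
    push_cast [Nat.cast_sub hp.le]
    rfl
  split_ifs with hT
  · have hR : #(S.R a b) = 1 := by
      have h1 := S.T_sq ha b
      rw [hT] at h1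
      have h2 := mul_left_cancel₀ S.card_F_ne ((mul_one _).trans h1)
      exact_mod_cast h2.symm
    have h1 : ∀ c, #{h | p * S.Z a b c h = S.P ^ 2 + (p - 1) * S.P} = 1 := by
      intro c
      obtain ⟨y, rfl⟩ : ∃ y, S.L a b y = c := by
        refine (S.exists_L_eq_or ha b c).resolve_right ?_
        rintro ⟨z, hz, hzc⟩
        apply hzc
        rw [card_le_one.1 hR.le z hz 0 (S.zero_mem_R a b), zero_mul, map_zero]
      rw [card_eq_one]
      refine ⟨S.tr (S.q a b y), ?_⟩
      ext h
      simp only [mem_filter, mem_univ, true_and, mem_singleton, hcast, S.Z_L ha]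
      rcases eq_or_ne (S.tr (S.q a b y) - h) 0 with h0 | h0
      · rw [h0, S.card_level.1, hT]
        simp [(sub_eq_zero.1 h0).symm]
      · rw [S.card_level.2 _ h0, hT]
        refine ⟨fun h2 => absurd ?_ (mul_ne_zero hp0 hP), fun h2 => absurd h2.symm (sub_ne_zero.1 h0)⟩
        linear_combination -h2
    have h2 : S.P ^ 2 = ∑ _c : F, 1 := by rw [← card_eq_sum_ones, card_univ, S.card_F]
    rw [card_eq_sum_card_fiberwise (f := Prod.fst) (t := univ) fun _ _ => mem_univ _]
    refine Eq.trans ?_ h2.symm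
    refine sum_congr rfl fun c _ => ?_
    refine Eq.trans ?_ (h1 c)
    rw [filter_filter]
    refine card_nbij' (fun t => t.2) (fun h => (c, h)) ?_ ?_ ?_ ?_
    · rintro ⟨c', h⟩ ht
      simp only [coe_filter, mem_univ, true_and, Set.mem_ofPred_eq] at ht ⊢
      rw [← ht.2]; exact ht.1
    · intro h hh
      simpa using hh
    · rintro ⟨c', h⟩ ht
      simp only [coe_filter, mem_univ, true_and, Set.mem_ofPred_eq] at ht
      rw [← ht.2]
    · intro h _; rfl
  · rw [card_eq_zero, filter_eq_empty_iff]
    rintro ⟨c, h⟩ - hZ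
    rw [hcast] at hZ
    rcases S.exists_L_eq_or ha b c with ⟨y, rfl⟩ | ⟨z, hz, hzc⟩
    · simp only [S.Z_L ha] at hZ
      rcases eq_or_ne (S.tr (S.q a b y) - h) 0 with h0 | h0
      · rw [h0, S.card_level.1] at hZ
        exact hT (mul_left_cancel₀ hp1 (add_left_cancel hZ))
      · rw [S.card_level.2 _ h0] at hZ
        have hT' : S.T a b = -((p - 1) * S.P) := by linear_combination -hZ
        by_cases hab : (a, b) = (0, 0)
        · obtain ⟨rfl, rfl⟩ := Prod.mk.inj hab
          rw [S.T_zero_zero] at hT'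
          have h1 : ((S.P + (p - 1) : ℕ) : ℂ) = 0 := by
            push_cast [Nat.cast_sub hp.le]
            apply mul_left_cancel₀ hP
            linear_combination hT'
          rw [Nat.cast_eq_zero] at h1
          omega
        · have h1 := S.T_sq ha b
          rw [hT', neg_sq, mul_pow, mul_comm] at h1
          have h2 := mul_left_cancel₀ S.card_F_ne h1
          have h3 : (p - 1) ^ 2 = #(S.R a b) := by
            rw [← Nat.cast_inj (R := ℂ), ← h2]
            push_cast [Nat.cast_sub hp.le]
            rfl
          have h4 : Even (#(S.R a b)) := by
            rw [← h3]
            exact (Nat.Odd.sub_odd S.odd_p odd_one).pow_of_ne_zero two_ne_zero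
          rw [← Nat.not_odd_iff_even] at h4
          apply h4
          rcases S.R_cases ha hab with h5 | h5 | ⟨h5, -⟩ <;> rw [h5]
          · exact odd_one
          · exact S.odd_u
          · exact S.odd_u.pow
    · simp only [S.Z_of_tr_ne ha hz hzc] at hZ
      exact mul_ne_zero hp1 hP (by linear_combination -hZ)

theorem card_quadruples :
    (#{t : F × F × F × ZMod p | S.τ t.1 = t.1 ∧
      p * S.Z t.1 t.2.1 t.2.2.1 t.2.2.2 = S.P ^ 2 + (p - 1) * S.P} : ℚ)
      = S.P ^ 2 * S.u * (S.P + 1) * (S.P ^ 2 - 1) / (2 * (S.u + 1)) := by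
  have h1 : #{t : F × F × F × ZMod p | S.τ t.1 = t.1 ∧
      p * S.Z t.1 t.2.1 t.2.2.1 t.2.2.2 = S.P ^ 2 + (p - 1) * S.P}
      = #{t ∈ S.K ×ˢ (univ : Finset F) | S.T t.1 t.2 = S.P} * S.P ^ 2 := by
    rw [card_eq_sum_card_fiberwise (f := fun t => (t.1, t.2.1)) (t := S.K ×ˢ (univ : Finset F))]
    · rw [← smul_eq_mul #_, ← sum_const, sum_filter]
      refine sum_congr rfl fun w hw => ?_
      rw [← S.card_Z_eq (mem_product.1 hw).1, filter_filter]
      refine card_nbij' (fun t => t.2.2) (fun t => (w.1, w.2, t)) ?_ ?_ ?_ ?_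
      · rintro ⟨a, b, t⟩ ht
        simp only [coe_filter, mem_univ, true_and, Set.mem_ofPred_eq] at ht ⊢
        rw [← ht.2]; exact ht.1.2
      · intro t ht
        simp only [coe_filter, mem_univ, true_and, Set.mem_ofPred_eq] at ht ⊢
        exact ⟨⟨S.mem_K.1 (mem_product.1 hw).1, ht⟩, trivial⟩
      · rintro ⟨a, b, t⟩ ht
        simp only [coe_filter, mem_univ, true_and, Set.mem_ofPred_eq] at ht
        rw [← ht.2]
      · intro t _; rfl
    · intro t ht
      simp only [coe_filter, mem_univ, true_and, Set.mem_ofPred_eq] at ht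
      exact mem_product.2 ⟨S.mem_K.2 ht.1, mem_univ _⟩
  have h2 : (#{t ∈ S.K ×ˢ (univ : Finset F) | S.T t.1 t.2 = S.P} : ℚ)
      * (2 * (S.u + 1)) = S.u * (S.P + 1) * (S.P ^ 2 - 1) := by
    apply Rat.cast_injective (α := ℂ)
    push_cast
    exact S.card_T_eq
  have h3 : (2 * (S.u + 1) : ℚ) ≠ 0 := by positivity
  rw [h1, eq_div_iff h3]
  push_cast
  linear_combination (S.P : ℚ) ^ 2 * h2

end KasamiData

section Frobenius

variable {F : Type} [Field F] {p : ℕ}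

theorem pow_pow_eq_of_dvd {x : F} {m n : ℕ} (hx : x ^ p ^ m = x) (h : m ∣ n) :
    x ^ p ^ n = x := by
  obtain ⟨j, rfl⟩ := h
  induction j with
  | zero => simp
  | succ j ih => rw [mul_add, mul_one, pow_add, pow_mul, ih, hx]

theorem pow_pow_gcd_eq {x : F} {m n : ℕ} (hm : x ^ p ^ m = x) (hn : x ^ p ^ n = x) :
    x ^ p ^ Nat.gcd m n = x := by
  have key : ∀ j, (fun y : F => y ^ p)^[j] x = x ^ p ^ j := by
    intro j
    rw [pow_iterate]
  have h1 : Function.IsPeriodicPt (fun y : F => y ^ p) m x := (key m).trans hm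
  have h2 : Function.IsPeriodicPt (fun y : F => y ^ p) n x := (key n).trans hn
  exact (key _).symm.trans (h1.gcd h2)

theorem pow_pow_gcd_eq_of_eq_neg {s l : ℕ} (hodd : Odd p) {v : F} (h1 : v ^ p ^ l = -v)
    (h2 : v ^ p ^ s = -v) : v ^ p ^ Nat.gcd (s + l) (2 * l) = v := by
  refine pow_pow_gcd_eq ?_ ?_
  · rw [pow_add, pow_mul, h2, (hodd.pow).neg_pow, h1, neg_neg]
  · rw [two_mul, pow_add, pow_mul, h1, (hodd.pow).neg_pow, h1, neg_neg]

theorem pow_pow_gcd_eq_of_eq [Fintype F] {s l : ℕ} (hF : Fintype.card F = p ^ (2 * s)) {z : F}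
    (h : z ^ p ^ l = z ^ p ^ s) : z ^ p ^ Nat.gcd (s + l) (2 * l) = z := by
  have h1 : z ^ p ^ (2 * s) = z := by rw [← hF, FiniteField.pow_card]
  have h2 : z ^ p ^ (s + l) = z := by
    rw [add_comm, pow_add, pow_mul, h, ← pow_mul, ← pow_add, ← two_mul, h1]
  refine pow_pow_gcd_eq h2 ?_
  rw [two_mul, pow_add, pow_mul, h, ← pow_mul, ← pow_add, h2]

theorem card_pow_pow_eq [Fintype F] [DecidableEq F] (hp : 1 < p) {m n : ℕ}
    (hF : Fintype.card F = p ^ m) (h : n ∣ m) :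
    #{x : F | x ^ p ^ n = x} = p ^ n := by
  have hpn : 1 ≤ p ^ n := Nat.one_le_pow _ _ (by omega)
  have hU : Nat.card Fˣ = p ^ m - 1 := by
    rw [Nat.card_eq_fintype_card, Fintype.card_units, hF]
  have hdvd : p ^ n - 1 ∣ p ^ m - 1 := by
    obtain ⟨j, rfl⟩ := h
    rw [pow_mul]
    simpa using Nat.sub_dvd_pow_sub_pow (p ^ n) 1 j
  have h1 := IsCyclic.card_powMonoidHom_ker (G := Fˣ) (p ^ n - 1)
  rw [hU, Nat.gcd_eq_right hdvd] at h1
  have h2 : ({x : F | x ^ p ^ n = x} : Finset F)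
      = insert 0 (({g : Fˣ | g ^ (p ^ n - 1) = 1} : Finset Fˣ).map ⟨Units.val, Units.val_injective⟩) := by
    ext x
    simp only [mem_filter, mem_univ, true_and, mem_insert, mem_map, Function.Embedding.coeFn_mk]
    have h3 : x ^ p ^ n = x ^ (p ^ n - 1) * x := by rw [← pow_succ, Nat.sub_add_cancel hpn]
    constructor
    · intro hx
      by_cases hx0 : x = 0
      · exact Or.inl hx0
      · refine Or.inr ⟨Units.mk0 x hx0, ?_, rfl⟩
        ext
        rw [Units.val_pow_eq_pow_val, Units.val_mk0, Units.val_one]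
        exact mul_right_cancel₀ hx0 (by rw [← h3, hx, one_mul])
    · rintro (rfl | ⟨g, hg, rfl⟩)
      · rw [zero_pow (by omega)]
      · rw [h3, ← Units.val_pow_eq_pow_val, hg, Units.val_one, one_mul]
  rw [h2, card_insert_of_notMem (by simp), card_map]
  have h4 : #({g : Fˣ | g ^ (p ^ n - 1) = 1} : Finset Fˣ) = p ^ n - 1 := by
    refine Eq.trans ?_ h1
    rw [← Nat.subtype_card _ (p := fun g => g ∈ (powMonoidHom (α := Fˣ) (p ^ n - 1)).ker)]
    intro g
    simp [MonoidHom.mem_ker]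
  rw [h4, Nat.sub_add_cancel hpn]

theorem exists_sq_eq [Fintype F] [Fact p.Prime] [CharP F p] (hodd : Odd p) {s : ℕ}
    (hF : Fintype.card F = p ^ (2 * s)) {y : F} (hy : y ^ (p - 1) = 1) :
    ∃ i : F, i ^ 2 = y ∧ i ^ p ^ 2 = i := by
  have hp := (Fact.out : p.Prime).one_lt
  obtain ⟨j, hj⟩ := hodd
  have hy0 : y ≠ 0 := by
    rintro rfl
    rw [zero_pow (by omega)] at hy
    exact zero_ne_one hy
  have hchar : ringChar F ≠ 2 := by
    rw [ringChar.eq F p]; omega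
  have hsq : IsSquare y := by
    rw [FiniteField.isSquare_iff hchar hy0, hF]
    obtain ⟨e, he⟩ : p - 1 ∣ p ^ s - 1 := by simpa using Nat.sub_dvd_pow_sub_pow p 1 s
    obtain ⟨f, hf⟩ : Odd (p ^ s) := Odd.pow ⟨j, hj⟩
    have h1 : p ^ (2 * s) / 2 = (p - 1) * (e * (f + 1)) := by
      have h2 : p ^ (2 * s) = 2 * ((p ^ s - 1) * (f + 1)) + 1 := by
        rw [mul_comm 2 s, pow_mul, hf, Nat.add_sub_cancel]; ring
      rw [h2, he]
      rw [mul_assoc]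
      omega
    rw [h1, pow_mul, hy, one_pow]
  obtain ⟨i, hi⟩ := hsq
  refine ⟨i, by rw [hi, sq], ?_⟩
  have h1 : p ^ 2 = 2 * ((p - 1) * (j + 1)) + 1 := by
    rw [hj, Nat.add_sub_cancel]; ring
  rw [h1, pow_succ, pow_mul, sq, ← hi, pow_mul, hy, one_pow, one_mul]

theorem algebraMap_trace_eq_trp [Fintype F] [Fact p.Prime] [Algebra (ZMod p) F] {m : ℕ}
    (hF : Fintype.card F = p ^ m) (z : F) :
    algebraMap (ZMod p) F (Algebra.trace (ZMod p) F z) = trp p m z := by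
  have h1 : Module.finrank (ZMod p) F = m := by
    have h2 := Module.card_eq_pow_finrank (K := ZMod p) (V := F)
    rw [hF, ZMod.card] at h2
    exact (Nat.pow_right_injective (Fact.out : p.Prime).two_le h2).symm
  rw [FiniteField.algebraMap_trace_eq_sum_pow, h1, Nat.card_zmod, trp]

theorem trace_ringEquiv [Algebra (ZMod p) F] (e : F ≃+* F) (z : F) :
    Algebra.trace (ZMod p) F (e z) = Algebra.trace (ZMod p) F z :=
  Algebra.trace_eq_of_algEquiv (AlgEquiv.ofRingEquiv (f := e) fun x =>
    RingHom.congr_fun (Subsingleton.elim (e.toRingHom.comp (algebraMap (ZMod p) F)) _) x) z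

theorem trp_add_self [Fact p.Prime] [CharP F p] {s : ℕ} {z : F} (hz : z ^ p ^ s = z) :
    trp p (2 * s) z = 2 * trp p s z := by
  rw [two_mul, two_mul, trp, sum_range_add]
  congr 1
  refine sum_congr rfl fun i _ => ?_
  rw [pow_add, pow_mul, hz]

end Frobenius

section FrobeniusData

variable {F : Type} [Field F] [Fintype F] [DecidableEq F] {p s l d : ℕ} [Fact p.Prime] [CharP F p]
  [Algebra (ZMod p) F]

/-- The automorphisms `x ↦ x ^ p ^ l` and `x ↦ x ^ p ^ s` of a field with `p ^ (2 * s)` elements,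
with the absolute trace. -/
noncomputable def frobeniusData (hodd : Odd p) (hs : 1 ≤ s)
    (hF : Fintype.card F = p ^ (2 * s)) (hd : Nat.gcd s l = d)
    (hd' : Nat.gcd (s + l) (2 * l) = d) (hdeven : Even d) : KasamiData p F where
  σ := iterateFrobeniusEquiv F p l
  τ := iterateFrobeniusEquiv F p s
  tr := (Algebra.trace (ZMod p) F).toAddMonoidHom
  P := p ^ s
  u := p ^ d
  odd_p := hodd
  two_ne := by
    have h : ringChar F ≠ 2 := by
      rw [ringChar.eq F p]; rintro rfl; exact absurd hodd (by decide)
    exact Ring.two_ne_zero h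
  one_lt_P := Nat.one_lt_pow (by omega) (Fact.out : p.Prime).one_lt
  one_lt_u := Nat.one_lt_pow (by rw [← hd]; exact (Nat.gcd_pos_of_pos_left _ hs).ne')
    (Fact.out : p.Prime).one_lt
  odd_u := hodd.pow
  tr_σ := trace_ringEquiv _
  tr_τ := trace_ringEquiv _
  tr_ne := by
    obtain ⟨x, hx⟩ := Algebra.trace_surjective (ZMod p) F 1
    exact ⟨x, by simp [hx]⟩
  τ_τ x := by
    simp only [iterateFrobeniusEquiv_def]
    rw [← pow_mul, ← pow_add, ← two_mul, ← hF, FiniteField.pow_card]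
  τ_σ x := by
    simp only [iterateFrobeniusEquiv_def]
    rw [← pow_mul, ← pow_mul, mul_comm]
  eq_zero_of_neg v h1 h2 := by
    simp only [iterateFrobeniusEquiv_def] at h1 h2
    have h3 := pow_pow_gcd_eq_of_eq_neg hodd h1 h2
    rw [hd'] at h3
    have h4 := pow_pow_eq_of_dvd h3 (hd ▸ Nat.gcd_dvd_right s l)
    have h : ringChar F ≠ 2 := by
      rw [ringChar.eq F p]; rintro rfl; exact absurd hodd (by decide)
    exact Ring.eq_self_iff_eq_zero_of_char_ne_two h |>.mp (h1.symm.trans h4)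
  τ_eq_of_σ_eq z h := by
    simp only [iterateFrobeniusEquiv_def] at h ⊢
    have h3 := pow_pow_gcd_eq_of_eq hF h
    rw [hd'] at h3
    exact pow_pow_eq_of_dvd h3 (hd ▸ Nat.gcd_dvd_left s l)
  exists_sq y hy := by
    obtain ⟨i, hi, hi2⟩ := exists_sq_eq hodd hF (y := algebraMap (ZMod p) F y)
      (by rw [← map_pow, ZMod.pow_card_sub_one_eq_one hy, map_one])
    have h2 : 2 ∣ d := hdeven.two_dvd
    refine ⟨i, fun x => ?_, ?_, ?_, ?_⟩
    · rw [hi, ← Algebra.smul_def]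
      simp
    · rintro rfl
      rw [zero_pow two_ne_zero] at hi
      exact hy ((map_eq_zero _).mp hi.symm)
    · rw [iterateFrobeniusEquiv_def]
      exact pow_pow_eq_of_dvd hi2 (h2.trans (hd ▸ Nat.gcd_dvd_right s l))
    · rw [iterateFrobeniusEquiv_def]
      exact pow_pow_eq_of_dvd hi2 (h2.trans (hd ▸ Nat.gcd_dvd_left s l))
  card_F := by rw [hF, mul_comm, pow_mul]
  card_K := by
    simp only [iterateFrobeniusEquiv_def]
    exact card_pow_pow_eq (Fact.out : p.Prime).one_lt hF (Dvd.intro_left 2 rfl)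
  card_k := by
    have h1 : d ∣ s := hd ▸ Nat.gcd_dvd_left s l
    have h2 : d ∣ l := hd ▸ Nat.gcd_dvd_right s l
    rw [← card_pow_pow_eq (Fact.out : p.Prime).one_lt hF (h1.mul_left 2)]
    refine congrArg card (filter_congr fun z _ => ?_)
    rw [iterateFrobeniusEquiv_def, iterateFrobeniusEquiv_def]
    constructor
    · intro h
      have h3 := pow_pow_gcd_eq_of_eq hF h
      rwa [hd'] at h3
    · intro h
      rw [pow_pow_eq_of_dvd h h1, pow_pow_eq_of_dvd h h2]

variable (hodd : Odd p) (hs : 1 ≤ s) (hF : Fintype.card F = p ^ (2 * s)) (hd : Nat.gcd s l = d)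
  (hd' : Nat.gcd (s + l) (2 * l) = d) (hdeven : Even d)

theorem cword_eq_algebraMap {a : F} (ha : a ^ p ^ s = a) (b c : F) (h : ZMod p) (x : F) :
    cword p s l a b c h x = algebraMap (ZMod p) F
      ((frobeniusData hodd hs hF hd hd' hdeven).tr
        ((frobeniusData hodd hs hF hd hd' hdeven).q a b x + c * x) + h) := by
  have h0 : (2 : F) ≠ 0 := (frobeniusData hodd hs hF hd hd' hdeven).two_ne
  have hτ : x ^ p ^ (2 * s) = x := by rw [← hF, FiniteField.pow_card]
  have h1 : (a * x ^ (p ^ s + 1) / 2) ^ p ^ s = a * x ^ (p ^ s + 1) / 2 := by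
    have h2 : (2 : F) ^ p ^ s = 2 := by
      rw [← iterateFrobeniusEquiv_def, map_ofNat]
    rw [div_pow, mul_pow, ha, h2, ← pow_mul, add_mul, ← pow_add, ← two_mul s, pow_add, hτ, one_mul,
      pow_succ, mul_comm x]
  have h2 : trp p s (a * x ^ (p ^ s + 1)) = trp p (2 * s) (a * x ^ (p ^ s + 1) / 2) := by
    rw [trp_add_self h1, trp, trp, mul_sum]
    refine sum_congr rfl fun j _ => ?_
    have h2 : (2 : F) ^ p ^ j = 2 := by
      rw [← iterateFrobeniusEquiv_def, map_ofNat]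
    rw [div_pow, h2, mul_div_cancel₀ _ h0]
  rw [cword, h2, ← algebraMap_trace_eq_trp hF, ← algebraMap_trace_eq_trp hF, ← map_add,
    ← map_add, map_add (algebraMap (ZMod p) F) _ h]
  congr 1
  · refine congrArg (algebraMap (ZMod p) F) (congrArg (Algebra.trace (ZMod p) F) ?_)
    simp only [KasamiData.q, frobeniusData, iterateFrobeniusEquiv_def]
    ring
  · exact (RingHom.congr_fun (Subsingleton.elim (ZMod.castHom dvd_rfl F) _) h)

theorem card_suppw_add {a : F} (ha : a ^ p ^ s = a) (b c : F) (h : ZMod p) :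
    #(suppw p s l a b c h) + (frobeniusData hodd hs hF hd hd' hdeven).Z a b c h
      = (p ^ s) ^ 2 := by
  rw [← pow_mul, mul_comm s, ← hF, ← card_univ,
    ← card_filter_add_card_filter_not (s := univ) fun x => cword p s l a b c h x ≠ 0, suppw,
    KasamiData.Z]
  congr 2
  ext x
  simp only [mem_filter, mem_univ, true_and, not_not,
    cword_eq_algebraMap hodd hs hF hd hd' hdeven ha, map_eq_zero]

theorem card_suppw_eq_iff {a : F} (ha : a ^ p ^ s = a) (b c : F) (h : ZMod p) :
    #(suppw p s l a b c h) = p ^ (s - 1) * (p - 1) * (p ^ s - 1) ↔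
      p * (frobeniusData hodd hs hF hd hd' hdeven).Z a b c h
        = (p ^ s) ^ 2 + (p - 1) * p ^ s := by
  have h1 := card_suppw_add hodd hs hF hd hd' hdeven ha b c h
  have hp := (Fact.out : p.Prime).one_lt
  obtain ⟨e, rfl⟩ : ∃ e, p = e + 1 := ⟨p - 1, by omega⟩
  have hM : (e + 1) ^ s = (e + 1) * (e + 1) ^ (s - 1) := by
    rw [← pow_succ', Nat.sub_add_cancel hs]
  have hpos : 0 < (e + 1) ^ s := by positivity
  obtain ⟨f, hf⟩ : ∃ f, (e + 1) ^ s = f + 1 := ⟨(e + 1) ^ s - 1, by omega⟩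
  generalize KasamiData.Z _ a b c h = Z at *
  generalize #(suppw _ s l a b c h) = W at *
  generalize (e + 1) ^ (s - 1) = M at *
  rw [hf] at h1 hM ⊢
  simp only [Nat.add_sub_cancel]
  zify at *
  have h2 : (e + 1 : ℤ) ≠ 0 := by positivity
  constructor
  · intro hW
    linear_combination (e + 1) * h1 - (e + 1) * hW + e * f * hM
  · intro hZ
    apply mul_left_cancel₀ h2
    linear_combination (e + 1) * h1 - hZ + e * f * hM

end FrobeniusData
end

theorem stmt8 (p s l : ℕ) [Fact p.Prime] (F : Type) [Field F] [Fintype F] [DecidableEq F]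
    [CharP F p] (hodd : Odd p) (hs : 2 ≤ s) (hl1 : 1 ≤ l) (hls : l ≠ s)
    (hl2 : l ≤ 2 * s - 1) (hF : Fintype.card F = p ^ (2 * s)) (d : ℕ)
    (hd : Nat.gcd s l = d) (hd' : Nat.gcd (s + l) (2 * l) = d) (hdeven : Even d) :
    (((Finset.univ : Finset (F × F × F × ZMod p)).filter fun t =>
        t.1 ^ p ^ s = t.1 ∧ (suppw p s l t.1 t.2.1 t.2.2.1 t.2.2.2).card
          = p ^ (s - 1) * (p - 1) * (p ^ s - 1)).card : ℚ)
      = (p : ℚ) ^ (2 * s + d) * ((p : ℚ) ^ s + 1) * ((p : ℚ) ^ (2 * s) - 1)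
          / (2 * ((p : ℚ) ^ d + 1)) := by
  let _ := ZMod.algebra F p
  have hs1 : 1 ≤ s := by omega
  have key := (frobeniusData hodd hs1 hF hd hd' hdeven).card_quadruples
  have hP : (frobeniusData hodd hs1 hF hd hd' hdeven).P = p ^ s := rfl
  have hu : (frobeniusData hodd hs1 hF hd hd' hdeven).u = p ^ d := rfl
  rw [hP, hu] at key
  have h1 : ((Finset.univ : Finset (F × F × F × ZMod p)).filter fun t =>
        t.1 ^ p ^ s = t.1 ∧ (suppw p s l t.1 t.2.1 t.2.2.1 t.2.2.2).card
          = p ^ (s - 1) * (p - 1) * (p ^ s - 1))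
      = Finset.univ.filter fun t : F × F × F × ZMod p =>
        (frobeniusData hodd hs1 hF hd hd' hdeven).τ t.1 = t.1 ∧
        p * (frobeniusData hodd hs1 hF hd hd' hdeven).Z t.1 t.2.1 t.2.2.1 t.2.2.2
          = (p ^ s) ^ 2 + (p - 1) * p ^ s := by
    refine Finset.filter_congr fun t _ => ?_
    have h2 : (frobeniusData hodd hs1 hF hd hd' hdeven).τ t.1 = t.1 ^ p ^ s :=
      iterateFrobeniusEquiv_def F p s t.1
    rw [h2]
    exact and_congr_right fun ha => card_suppw_eq_iff hodd hs1 hF hd hd' hdeven ha _ _ _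
  rw [h1, key]
  push_cast
  ring
end

section
/- Assume gcd(s+l,2l) = gcd(s,l) = d and d is even. Then for each sign ε ∈ {+1, −1}, the number of quadruples (a,b,c,h) ∈ F_{p^s} × F_q × F_q × F_p for which the codeword c(a,b,c,h) has Hamming weight p^{s+d/2−1}(p−1)(p^{s−d/2} + ε) equals p^{3s−2d}(p^m−1)/2. -/
open Finset

/-- The exponential sum of a quadratic form over a finite field with respect to an additive
character of the base field. -/
noncomputable def quadExpSum {K V : Type*} [Field K] [AddCommGroup V] [Module K V] [Fintype V]
    (ψ : AddChar K ℂ) (Q : QuadraticForm K V) : ℂ :=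
  ∑ x, ψ (Q x)

section QuadraticForms

variable {K V : Type*} [Field K] [AddCommGroup V] [Module K V]

lemma sum_addChar_linear_of_ne_zero [Fintype V] {ψ : AddChar K ℂ} (hψ : ψ ≠ 1) {f : V →ₗ[K] K} (hf : f ≠ 0) :
    ∑ x, ψ (f x) = 0 := by
  have key : ψ.compAddMonoidHom f.toAddMonoidHom ≠ 1 := by
    obtain ⟨k, hk⟩ := AddChar.ne_one_iff.1 hψ
    obtain ⟨x, hx⟩ := LinearMap.surjective hf k
    refine AddChar.ne_one_iff.2 ⟨x, ?_⟩
    simpa [hx] using hk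
  simpa using AddChar.sum_eq_zero_of_ne_one key

open Classical in
lemma sum_addChar_linear [Fintype V] {ψ : AddChar K ℂ} (hψ : ψ ≠ 1) (f : V →ₗ[K] K) :
    ∑ x, ψ (f x) = if f = 0 then (Fintype.card V : ℂ) else 0 := by
  split_ifs with hf
  · simp [hf]
  · exact sum_addChar_linear_of_ne_zero hψ hf

lemma quadExpSum_sq_smul [Fintype V] {ψ : AddChar K ℂ} (Q : QuadraticForm K V) {μ : K} (hμ : μ ≠ 0) :
    quadExpSum ψ ((μ * μ) • Q) = quadExpSum ψ Q := by
  unfold quadExpSum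
  refine Fintype.sum_equiv (LinearEquiv.smulOfNeZero K V μ hμ).toEquiv _ _ fun x => ?_
  simp [QuadraticMap.map_smul]

lemma quadForm_eq_zero_of_mem_ker (h2 : (2 : K) ≠ 0) (Q : QuadraticForm K V) {x : V}
    (hx : x ∈ LinearMap.ker Q.polarBilin) : Q x = 0 := by
  have h := LinearMap.congr_fun (LinearMap.mem_ker.1 hx) x
  simp only [QuadraticMap.polarBilin_apply_apply, QuadraticMap.polar_self,
    LinearMap.zero_apply] at h
  simpa [h2] using h

lemma quadExpSum_sq [Fintype V] {ψ : AddChar K ℂ} (hψ : ψ ≠ 1) (h2 : (2 : K) ≠ 0) (hi : IsSquare (-1 : K))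
    (Q : QuadraticForm K V) :
    quadExpSum ψ Q ^ 2 = Fintype.card V * Nat.card (LinearMap.ker Q.polarBilin) := by
  classical
  obtain ⟨μ, hμ⟩ := hi
  have hμ0 : μ ≠ 0 := by rintro rfl; simp at hμ
  have hT : quadExpSum ψ Q = ∑ y, ψ (-Q y) := by
    rw [← quadExpSum_sq_smul Q hμ0, ← hμ]
    simp [quadExpSum]
  have h1 : quadExpSum ψ Q ^ 2 = ∑ y, ∑ x, ψ (Q x) * ψ (Q.polarBilin x y) := by
    rw [sq]
    nth_rw 2 [hT]
    rw [quadExpSum, sum_mul_sum, sum_comm]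
    refine sum_congr rfl fun y _ => ?_
    rw [← Equiv.sum_comp (Equiv.addRight y)]
    refine sum_congr rfl fun x _ => ?_
    rw [← AddChar.map_add_eq_mul, ← AddChar.map_add_eq_mul]
    congr 1
    simp [QuadraticMap.polar]
    ring
  rw [h1, sum_comm]
  simp_rw [← mul_sum, sum_addChar_linear hψ]
  have h3 : ∀ x, ψ (Q x) * (if Q.polarBilin x = 0 then (Fintype.card V : ℂ) else 0)
      = if x ∈ LinearMap.ker Q.polarBilin then (Fintype.card V : ℂ) else 0 := by
    intro x
    by_cases hx : x ∈ LinearMap.ker Q.polarBilin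
    · rw [if_pos hx, if_pos (LinearMap.mem_ker.1 hx), quadForm_eq_zero_of_mem_ker h2 Q hx]
      simp
    · rw [if_neg hx, if_neg (fun h => hx (LinearMap.mem_ker.2 h)), mul_zero]
  simp_rw [h3]
  rw [← sum_filter, sum_const, nsmul_eq_mul, mul_comm, Nat.card_eq_fintype_card,
    Fintype.card_subtype]

lemma quadExpSum_isometryEquiv [Fintype V] {ψ : AddChar K ℂ} {W : Type*} [AddCommGroup W] [Module K W] [Fintype W]
    {Q : QuadraticForm K V} {R : QuadraticForm K W} (e : Q.IsometryEquiv R) :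
    quadExpSum ψ Q = quadExpSum ψ R := by
  refine Fintype.sum_equiv e.toLinearEquiv.toEquiv _ _ fun x => ?_
  exact congrArg ψ (e.map_app x).symm

end QuadraticForms

section Diagonal

variable {K : Type*} [Field K] [Fintype K] {ψ : AddChar K ℂ}

lemma sum_addChar_mul (hψ : ψ ≠ 1) {w : K} (hw : w ≠ 0) : ∑ x, ψ (w * x) = 0 := by
  have := sum_addChar_linear_of_ne_zero hψ (f := LinearMap.mulLeft K w)
    (fun h => hw (by simpa using LinearMap.congr_fun h 1))
  simpa using this

lemma sum_addChar_sq_eq (h2 : (2 : K) ≠ 0) [DecidableEq K] (w : K) :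
    ∑ x, ψ (w * (x * x)) = ∑ y, (quadraticChar K y + 1 : ℤ) * ψ (w * y) := by
  have hc : ringChar K ≠ 2 := by
    intro h
    apply h2
    have := ringChar.Nat.cast_ringChar (R := K)
    rw [h] at this
    exact_mod_cast this
  rw [← sum_fiberwise_of_maps_to (s := univ) (t := univ) (g := fun x : K => x * x)
    (fun _ _ => mem_univ _)]
  refine sum_congr rfl fun y _ => ?_
  rw [← quadraticChar_card_sqrts hc y, sum_congr rfl (g := fun _ => ψ (w * y))]
  · rw [sum_const, nsmul_eq_mul]
    congr 2
    simp [sq]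
  · intro x hx
    simp [(mem_filter.1 hx).2]

lemma sum_addChar_nonsquare_mul (hψ : ψ ≠ 1) (h2 : (2 : K) ≠ 0) {c w : K} (hc : ¬ IsSquare c)
    (hw : w ≠ 0) : ∑ x, ψ (c * w * (x * x)) = - ∑ x, ψ (w * (x * x)) := by
  classical
  have hc0 : c ≠ 0 := by rintro rfl; exact hc (by simp)
  rw [sum_addChar_sq_eq h2, sum_addChar_sq_eq h2, ← sum_neg_distrib]
  have hw' := sum_addChar_mul hψ hw
  have hcw := sum_addChar_mul hψ (mul_ne_zero hc0 hw)
  simp only [Int.cast_add, Int.cast_one, add_mul, one_mul, sum_add_distrib, hcw, neg_add,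
    sum_neg_distrib, hw', neg_zero, add_zero]
  rw [← Equiv.sum_comp (Equiv.mulLeft₀ c hc0) (fun x => ((quadraticChar K x : ℤ) : ℂ) * ψ (w * x)),
    ← sum_neg_distrib]
  refine sum_congr rfl fun x _ => ?_
  simp only [Equiv.mulLeft₀_apply]
  rw [map_mul (quadraticChar K), quadraticChar_neg_one_iff_not_isSquare.2 hc,
    show c * w * x = w * (c * x) by ring]
  push_cast
  ring

lemma sum_addChar_mul_sq_sq (hψ : ψ ≠ 1) (h2 : (2 : K) ≠ 0) (hi : IsSquare (-1 : K)) {w : K}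
    (hw : w ≠ 0) : (∑ x, ψ (w * (x * x))) ^ 2 = Fintype.card K := by
  obtain ⟨μ, hμ⟩ := hi
  have hμ0 : μ ≠ 0 := by rintro rfl; simp at hμ
  rw [sq]
  nth_rw 2 [← Equiv.sum_comp (Equiv.mulLeft₀ μ hμ0)]
  rw [sum_mul_sum, sum_comm]
  have h1 : ∀ y, ∑ x, ψ (w * (x * x)) * ψ (w * (Equiv.mulLeft₀ μ hμ0 y * Equiv.mulLeft₀ μ hμ0 y))
      = ∑ x, ψ (w * (x * x)) * ψ (2 * w * x * y) := by
    intro y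
    rw [← Equiv.sum_comp (Equiv.addRight y)]
    refine sum_congr rfl fun x _ => ?_
    rw [← AddChar.map_add_eq_mul, ← AddChar.map_add_eq_mul]
    congr 1
    simp only [Equiv.coe_addRight, Equiv.mulLeft₀_apply]
    linear_combination (-w * y * y) * hμ
  simp_rw [h1]
  rw [sum_comm]
  simp_rw [← mul_sum]
  rw [sum_eq_single 0]
  · simp
  · intro x _ hx
    rw [sum_addChar_mul hψ (mul_ne_zero (mul_ne_zero h2 hw) hx), mul_zero]
  · simp

end Diagonal

section SignChange

variable {K V : Type*} [Field K] [Fintype K] [AddCommGroup V] [Module K V] [Fintype V]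
  {ψ : AddChar K ℂ}

lemma quadExpSum_weightedSumSquares {n : ℕ} (w : Fin n → K) :
    quadExpSum ψ (QuadraticMap.weightedSumSquares K w) = ∏ i, ∑ x, ψ (w i * (x * x)) := by
  rw [quadExpSum, Finset.prod_univ_sum, Fintype.piFinset_univ]
  refine sum_congr rfl fun x _ => ?_
  rw [QuadraticMap.weightedSumSquares_apply]
  simp only [smul_eq_mul]
  exact map_prod ψ.toMonoidHom (fun i => Multiplicative.ofAdd (w i * (x i * x i))) univ

/-- If the rank of `Q` is odd, multiplying `Q` by a nonsquare changes the sign of its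
exponential sum. -/
lemma quadExpSum_nonsquare_smul (hψ : ψ ≠ 1) (h2 : (2 : K) ≠ 0) (hi : IsSquare (-1 : K))
    {c : K} (hc : ¬ IsSquare c) (Q : QuadraticForm K V) (hn : Even (Module.finrank K V))
    (hr : Nat.card (LinearMap.ker Q.polarBilin) = Fintype.card K) :
    quadExpSum ψ (c • Q) = - quadExpSum ψ Q := by
  classical
  have : Invertible (2 : K) := invertibleOfNonzero h2
  obtain ⟨n, hn', w, ⟨e⟩⟩ : ∃ n, Module.finrank K V = n ∧ ∃ w : Fin n → K,
      QuadraticMap.Equivalent Q (QuadraticMap.weightedSumSquares K w) :=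
    ⟨_, rfl, QuadraticForm.equivalent_weightedSumSquares Q⟩
  rw [hn'] at hn
  have hc' : quadExpSum ψ (c • Q)
      = quadExpSum ψ (QuadraticMap.weightedSumSquares K fun i => c * w i) := by
    refine quadExpSum_isometryEquiv ⟨e.toLinearEquiv, fun x => ?_⟩
    have := e.map_app x
    simp only [QuadraticMap.weightedSumSquares_apply, smul_apply, smul_eq_mul]
      at this ⊢
    rw [← this, mul_sum]
    exact sum_congr rfl fun i _ => mul_assoc _ _ _
  have hsq := quadExpSum_sq hψ h2 hi Q
  rw [quadExpSum_isometryEquiv e, quadExpSum_weightedSumSquares] at *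
  rw [hc']
  set Z := univ.filter fun i => w i = 0 with hZ
  have hfac : ∀ i, (∑ x, ψ (c * w i * (x * x)))
      = (if w i = 0 then 1 else -1) * ∑ x, ψ (w i * (x * x)) := by
    intro i
    split_ifs with h
    · simp [h]
    · rw [sum_addChar_nonsquare_mul hψ h2 hc h, neg_one_mul]
  have hnorm : ∀ i, (∑ x, ψ (w i * (x * x))) ^ 2
      = (Fintype.card K : ℂ) * (if w i = 0 then (Fintype.card K : ℂ) else 1) := by
    intro i
    split_ifs with h
    · simp [h, sq]
    · rw [sum_addChar_mul_sq_sq hψ h2 hi h, mul_one]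
  rw [← prod_pow, prod_congr rfl fun i _ => hnorm i, prod_mul_distrib, prod_const, card_univ,
    Fintype.card_fin, ← prod_filter, prod_const, hr, Module.card_eq_pow_finrank (K := K) (V := V), hn'] at hsq
  have hK : 1 < Fintype.card K := Fintype.one_lt_card
  have hZ1 : Z.card = 1 := by
    have h1 : Fintype.card K ^ n * Fintype.card K ^ Z.card
        = Fintype.card K ^ n * Fintype.card K := by exact_mod_cast hsq
    have h3 := Nat.eq_of_mul_eq_mul_left (pow_pos (by omega) n) h1
    exact Nat.pow_right_injective hK (by simpa using h3)
  have hsign : (∏ i : Fin n, if w i = 0 then (1 : ℂ) else -1) = -1 := by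
    rw [prod_ite, prod_const_one, one_mul, prod_const]
    have hadd := card_filter_add_card_filter_not (s := (univ : Finset (Fin n))) (fun i => w i = 0)
    rw [card_univ, Fintype.card_fin] at hadd
    refine Odd.neg_one_pow ?_
    rw [← hadd] at hn
    rw [← hZ, hZ1] at hn
    grind
  rw [prod_congr rfl fun i _ => hfac i, prod_mul_distrib, hsign, neg_one_mul]

end SignChange

section ZeroCount

variable {p : ℕ} [Fact p.Prime] {K V : Type*} [Field K] [Algebra (ZMod p) K]
  [AddCommGroup V] [Module K V]

lemma mem_range_polarBilin [FiniteDimensional K V] (Q : QuadraticForm K V) {f : Module.Dual K V}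
    (hf : ∀ x ∈ LinearMap.ker Q.polarBilin, f x = 0) : ∃ v, Q.polarBilin v = f := by
  have h : f ∈ LinearMap.range (LinearMap.dualMap Q.polarBilin) := by
    rw [LinearMap.range_dualMap_eq_dualAnnihilator_ker]
    exact (Submodule.mem_dualAnnihilator f).2 hf
  obtain ⟨g, hg⟩ := h
  obtain ⟨w, rfl⟩ := (Module.evalEquiv K V).surjective g
  refine ⟨w, ?_⟩
  rw [← hg]
  ext x
  simp [QuadraticMap.polar_comm]

/-- The additive character `e ∘ θ` of `K`. -/
def compLinearChar (e : AddChar (ZMod p) ℂ) (θ : K →ₗ[ZMod p] ZMod p) : AddChar K ℂ :=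
  e.compAddMonoidHom θ.toAddMonoidHom

@[simp] lemma compLinearChar_apply (e : AddChar (ZMod p) ℂ) (θ : K →ₗ[ZMod p] ZMod p) (x : K) :
    compLinearChar e θ x = e (θ x) := rfl

lemma compLinearChar_ne_one {e : AddChar (ZMod p) ℂ} (he : e ≠ 1) {θ : K →ₗ[ZMod p] ZMod p}
    (hθ : θ ≠ 0) : compLinearChar e θ ≠ 1 := by
  obtain ⟨k, hk⟩ := AddChar.ne_one_iff.1 he
  obtain ⟨x, hx⟩ := LinearMap.surjective hθ k
  exact AddChar.ne_one_iff.2 ⟨x, by simpa [hx] using hk⟩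

variable [Fintype V]

/-- The number of zeros of the function `x ↦ θ (Q x + f x) + h`. -/
noncomputable def zeroCount (θ : K →ₗ[ZMod p] ZMod p) (Q : QuadraticForm K V)
    (f : Module.Dual K V) (h : ZMod p) : ℕ := by
  classical exact (univ.filter fun x => θ (Q x + f x) + h = 0).card

lemma sum_addChar_zmod {e : AddChar (ZMod p) ℂ} (he : e ≠ 1) (u : ZMod p) :
    ∑ t, e (t * u) = if u = 0 then (p : ℂ) else 0 := by
  split_ifs with hu
  · simp [hu, ZMod.card]
  · simpa only [mul_comm] using sum_addChar_mul he hu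

lemma mul_zeroCount {e : AddChar (ZMod p) ℂ} (he : e ≠ 1) (θ : K →ₗ[ZMod p] ZMod p)
    (Q : QuadraticForm K V) (f : Module.Dual K V) (h : ZMod p) :
    (p : ℂ) * zeroCount θ Q f h
      = Fintype.card V + ∑ t ∈ univ.erase 0, e (t * h) * ∑ x, e (t * θ (Q x + f x)) := by
  classical
  have h1 : (p : ℂ) * zeroCount θ Q f h = ∑ x, ∑ t, e (t * (θ (Q x + f x) + h)) := by
    simp_rw [sum_addChar_zmod he]
    rw [zeroCount, ← sum_filter, sum_const, nsmul_eq_mul, mul_comm]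
  rw [h1, sum_comm, ← add_sum_erase _ _ (mem_univ (0 : ZMod p))]
  congr 1
  · simp
  · refine sum_congr rfl fun t _ => ?_
    rw [mul_sum]
    refine sum_congr rfl fun x _ => ?_
    rw [mul_add, add_comm, AddChar.map_add_eq_mul]

lemma mul_zeroCount_of_notMem_range {e : AddChar (ZMod p) ℂ} (he : e ≠ 1)
    {θ : K →ₗ[ZMod p] ZMod p} (hθ : θ ≠ 0) (h2 : (2 : K) ≠ 0)
    (Q : QuadraticForm K V) {f : Module.Dual K V} (hf : ¬ ∃ v, Q.polarBilin v = f) (h : ZMod p) :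
    (p : ℂ) * zeroCount θ Q f h = Fintype.card V := by
  rw [mul_zeroCount he, sum_eq_zero, add_zero]
  intro t ht
  have ht0 : t ≠ 0 := (mem_erase.1 ht).1
  have hr : ∃ r ∈ LinearMap.ker Q.polarBilin, f r ≠ 0 := by
    by_contra! H
    exact hf (mem_range_polarBilin Q H)
  obtain ⟨r, hr, hfr⟩ := hr
  obtain ⟨k, hk⟩ := AddChar.ne_one_iff.1 he
  obtain ⟨a, ha⟩ := LinearMap.surjective hθ (t⁻¹ * k)
  set v := (a * (f r)⁻¹) • r with hv
  have hvr : v ∈ LinearMap.ker Q.polarBilin := Submodule.smul_mem _ _ hr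
  have hfv : f v = a := by simp [hv, hfr]
  have hshift : ∀ x, Q (x + v) + f (x + v) = a + (Q x + f x) := by
    intro x
    have h3 := LinearMap.congr_fun (LinearMap.mem_ker.1 hvr) x
    simp only [QuadraticMap.polarBilin_apply_apply, QuadraticMap.polar, LinearMap.zero_apply,
      quadForm_eq_zero_of_mem_ker h2 Q hvr] at h3
    rw [map_add f, hfv, add_comm x v]
    linear_combination h3
  have hS : ∑ x, e (t * θ (Q x + f x)) = e k * ∑ x, e (t * θ (Q x + f x)) := by
    conv_lhs => rw [← Equiv.sum_comp (Equiv.addRight v)]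
    rw [mul_sum]
    refine sum_congr rfl fun x _ => ?_
    rw [Equiv.coe_addRight, hshift, map_add, ha, mul_add, mul_inv_cancel_left₀ ht0,
      AddChar.map_add_eq_mul]
  have h4 : (e k - 1) * ∑ x, e (t * θ (Q x + f x)) = 0 := by linear_combination -hS
  rw [(mul_eq_zero.1 h4).resolve_left (sub_ne_zero.2 hk), mul_zero]

lemma mul_zeroCount_polarBilin {e : AddChar (ZMod p) ℂ} (he : e ≠ 1)
    {θ : K →ₗ[ZMod p] ZMod p} (hsq : ∀ t : ZMod p, IsSquare (algebraMap (ZMod p) K t))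
    (Q : QuadraticForm K V) (v : V) (h : ZMod p) :
    (p : ℂ) * zeroCount θ Q (Q.polarBilin v) h = Fintype.card V
      + ((if h = θ (Q v) then (p : ℂ) else 0) - 1) * quadExpSum (compLinearChar e θ) Q := by
  classical
  rw [mul_zeroCount he]
  congr 1
  have h1 : ∀ t ∈ univ.erase (0 : ZMod p),
      e (t * h) * ∑ x, e (t * θ (Q x + Q.polarBilin v x))
        = e (t * (h - θ (Q v))) * quadExpSum (compLinearChar e θ) Q := by
    intro t ht
    have ht0 : t ≠ 0 := (mem_erase.1 ht).1
    obtain ⟨μ, hμ⟩ := hsq t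
    have hμ0 : μ ≠ 0 := by
      rintro rfl
      exact ht0 (by simpa using hμ)
    rw [← quadExpSum_sq_smul Q hμ0, ← hμ, quadExpSum]
    rw [← Equiv.sum_comp (Equiv.addLeft v) (fun x => (compLinearChar e θ) _), mul_sum, mul_sum]
    refine sum_congr rfl fun x _ => ?_
    have h3 : ∀ k : K, θ (algebraMap (ZMod p) K t * k) = t * θ k := fun k => by
      rw [← Algebra.smul_def, map_smul, smul_eq_mul]
    rw [compLinearChar_apply, smul_apply, smul_eq_mul, h3, ← AddChar.map_add_eq_mul,
      ← AddChar.map_add_eq_mul]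
    congr 1
    have h4 : Q (v + x) = Q x + Q.polarBilin v x + Q v := by
      simp [QuadraticMap.polar]
    rw [Equiv.coe_addLeft, h4, map_add θ (_ + _)]
    ring
  rw [sum_congr rfl h1, ← sum_mul]
  congr 1
  have h5 := sum_addChar_zmod he (h - θ (Q v))
  rw [← add_sum_erase _ _ (mem_univ (0 : ZMod p)), zero_mul, AddChar.map_zero_eq_one] at h5
  simp only [sub_eq_zero] at h5
  rw [← h5]
  ring

/-- The pairs `(f, h)` for which `x ↦ θ (Q x + f x) + h` has the extremal number of zeros
determined by `τ`, where `τ` is the exponential sum of `Q`. -/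
lemma card_zeroCount_eq_mul_card_ker {e : AddChar (ZMod p) ℂ} (he : e ≠ 1)
    {θ : K →ₗ[ZMod p] ZMod p} (hθ : θ ≠ 0) (h2 : (2 : K) ≠ 0)
    (hsq : ∀ t : ZMod p, IsSquare (algebraMap (ZMod p) K t))
    (Q : QuadraticForm K V) {τ : ℂ} (hτ : τ ≠ 0) (hT : quadExpSum (compLinearChar e θ) Q = τ) :
    Nat.card {t : Module.Dual K V × ZMod p //
        (p : ℂ) * zeroCount θ Q t.1 t.2 = Fintype.card V + (p - 1) * τ}
      * Nat.card (LinearMap.ker Q.polarBilin) = Fintype.card V := by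
  have hp : p.Prime := Fact.out
  have hp0 : (p : ℂ) ≠ 0 := by exact_mod_cast hp.ne_zero
  have hp1 : (p : ℂ) - 1 ≠ 0 := sub_ne_zero.2 (by exact_mod_cast hp.one_lt.ne')
  have key : ∀ f h, (p : ℂ) * zeroCount θ Q f h = Fintype.card V + (p - 1) * τ ↔
      ∃ v, Q.polarBilin v = f ∧ h = θ (Q v) := by
    intro f h
    constructor
    · intro H
      by_cases hf : ∃ v, Q.polarBilin v = f
      · obtain ⟨v, rfl⟩ := hf
        refine ⟨v, rfl, ?_⟩
        by_contra hne
        rw [mul_zeroCount_polarBilin he hsq, if_neg hne, hT] at H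
        exact mul_ne_zero hp0 hτ (by linear_combination -H)
      · rw [mul_zeroCount_of_notMem_range he hθ h2 Q hf] at H
        exact (mul_ne_zero hp1 hτ (by linear_combination -H)).elim
    · rintro ⟨v, rfl, rfl⟩
      rw [mul_zeroCount_polarBilin he hsq, if_pos rfl, hT]
  have hwell : ∀ v w, Q.polarBilin v = Q.polarBilin w → Q v = Q w := by
    intro v w hvw
    have hk : v - w ∈ LinearMap.ker Q.polarBilin := by
      rw [LinearMap.mem_ker, map_sub, hvw, sub_self]
    have h3 : QuadraticMap.polar Q (v - w) w = 0 :=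
      LinearMap.congr_fun (LinearMap.mem_ker.1 hk) w
    rwa [QuadraticMap.polar, sub_add_cancel, quadForm_eq_zero_of_mem_ker h2 Q hk, sub_zero,
      sub_eq_zero] at h3
  have hcard : Nat.card {t : Module.Dual K V × ZMod p //
        (p : ℂ) * zeroCount θ Q t.1 t.2 = Fintype.card V + (p - 1) * τ}
      = Nat.card (LinearMap.range Q.polarBilin) := by
    refine Nat.card_congr (Equiv.ofBijective (fun t => ⟨t.1.1, ?_⟩) ⟨?_, ?_⟩)
    · obtain ⟨v, hv, _⟩ := (key _ _).1 t.2
      exact ⟨v, hv⟩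
    · rintro ⟨⟨f, h⟩, H⟩ ⟨⟨f', h'⟩, H'⟩ heq
      have hff : f = f' := congrArg Subtype.val heq
      subst hff
      obtain ⟨v, hv, rfl⟩ := (key _ _).1 H
      obtain ⟨w, hw, rfl⟩ := (key _ _).1 H'
      have := hwell v w (hv.trans hw.symm)
      simp only [this]
    · rintro ⟨f, v, hv⟩
      exact ⟨⟨(f, θ (Q v)), (key _ _).2 ⟨v, hv, rfl⟩⟩, rfl⟩
  rw [hcard, ← Nat.card_congr Q.polarBilin.quotKerEquivRange.toEquiv,
    ← Nat.card_eq_fintype_card (α := V),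
    Submodule.card_eq_card_quotient_mul_card (LinearMap.ker Q.polarBilin), mul_comm]

lemma quadExpSum_eq_of_mul_zeroCount_eq {e : AddChar (ZMod p) ℂ} (he : e ≠ 1)
    {θ : K →ₗ[ZMod p] ZMod p} (hθ : θ ≠ 0) (h2 : (2 : K) ≠ 0)
    (hsq : ∀ t : ZMod p, IsSquare (algebraMap (ZMod p) K t))
    (Q : QuadraticForm K V) {τ : ℂ} (hτ : τ ≠ 0)
    (hT : quadExpSum (compLinearChar e θ) Q ≠ -((p - 1) * τ)) {f : Module.Dual K V} {h : ZMod p}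
    (H : (p : ℂ) * zeroCount θ Q f h = Fintype.card V + (p - 1) * τ) :
    quadExpSum (compLinearChar e θ) Q = τ := by
  have hp : p.Prime := Fact.out
  have hp1 : (p : ℂ) - 1 ≠ 0 := sub_ne_zero.2 (by exact_mod_cast hp.one_lt.ne')
  by_cases hf : ∃ v, Q.polarBilin v = f
  · obtain ⟨v, rfl⟩ := hf
    rw [mul_zeroCount_polarBilin he hsq] at H
    split_ifs at H with hh
    · exact mul_left_cancel₀ hp1 (by linear_combination H)
    · exact (hT (by linear_combination -H)).elim
  · rw [mul_zeroCount_of_notMem_range he hθ h2 Q hf] at H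
    exact (mul_ne_zero hp1 hτ (by linear_combination -H)).elim

end ZeroCount

section RadicalCount

variable {K F : Type*} [Field K] [Field F] [Algebra K F]

/-- The map `x ↦ a S(x) + b L(x) + L⁻¹(b x)`, whose kernel is the radical of the quadratic form
`x ↦ Tr(a x S(x) / 2 + b x L(x))`. -/
noncomputable def radMap (S L : F ≃ₐ[K] F) (a b : F) : F →ₗ[K] F :=
  LinearMap.mulLeft K a ∘ₗ S.toLinearMap + LinearMap.mulLeft K b ∘ₗ L.toLinearMap
    + L.symm.toLinearMap ∘ₗ LinearMap.mulLeft K b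

@[simp] lemma radMap_apply (S L : F ≃ₐ[K] F) (a b x : F) :
    radMap S L a b x = a * S x + b * L x + L.symm (b * x) := rfl

/-- Two commuting automorphisms `S`, `L` of `F` over `K` with `S² = 1`, such that `K` is the fixed
field of the subgroup generated by `S L` and `L²`. -/
structure IsKasamiPair (S L : F ≃ₐ[K] F) : Prop where
  invol : ∀ z, S (S z) = z
  comm : ∀ z, S (L z) = L (S z)
  fixed : ∀ z, S (L z) = z → L (L z) = z → ∃ k, algebraMap K F k = z

variable {S L : F ≃ₐ[K] F}

namespace IsKasamiPair

lemma comm_symm (h : IsKasamiPair S L) (z : F) : S (L.symm z) = L.symm (S z) := by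
  apply L.injective
  rw [← h.comm, L.apply_symm_apply, L.apply_symm_apply]

lemma exists_of_eq (h : IsKasamiPair S L) {z : F} (hz : L z = S z) :
    ∃ k, algebraMap K F k = z :=
  h.fixed z (by rw [hz, h.invol]) (by rw [hz, ← h.comm, hz, h.invol])

lemma eq_zero_of_neg (h : IsKasamiPair S L) (h2 : (2 : F) ≠ 0) {z : F} (hS : S z = -z)
    (hL : L z = -z) : z = 0 := by
  obtain ⟨k, rfl⟩ := h.exists_of_eq (hL.trans hS.symm)
  rw [AlgEquiv.commutes] at hS
  exact (mul_eq_zero.1 (show 2 * algebraMap K F k = 0 by linear_combination hS)).resolve_left h2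

/-- If `1` lies in the radical and `a` is fixed by `S`, then so is `b`. -/
lemma fixed_of_one_mem (h : IsKasamiPair S L) (h2 : (2 : F) ≠ 0) {a b : F} (ha : S a = a)
    (h1 : radMap S L a b 1 = 0) : S b = b := by
  have h3 : a + b + L.symm b = 0 := by simpa using h1
  have h4 : a + S b + L.symm (S b) = 0 := by
    have := congrArg S h3
    rwa [map_add, map_add, ha, h.comm_symm, map_zero] at this
  have h5 : L.symm (S b - b) = -(S b - b) := by
    rw [map_sub]
    linear_combination h4 - h3
  refine sub_eq_zero.1 (h.eq_zero_of_neg h2 ?_ ?_)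
  · rw [map_sub, h.invol, neg_sub]
  · rw [L.symm_apply_eq, map_neg] at h5
    linear_combination h5

lemma radMap_eq (h : IsKasamiPair S L) {b : F} (hb : S b = b) (z : F) :
    radMap S L (-(b + L.symm b)) b z
      = L (L.symm b * (z - S (L.symm z))) - S (L.symm b * (z - S (L.symm z))) := by
  simp only [radMap_apply, map_mul, map_sub, L.apply_symm_apply, h.invol, h.comm_symm, hb]
  ring

lemma mem_ker_radMap_iff (h : IsKasamiPair S L) {b : F} (hb : S b = b) (z : F) :
    z ∈ LinearMap.ker (radMap S L (-(b + L.symm b)) b)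
      ↔ ∃ k, algebraMap K F k = L.symm b * (z - S (L.symm z)) := by
  rw [LinearMap.mem_ker, h.radMap_eq hb, sub_eq_zero]
  constructor
  · exact h.exists_of_eq
  · rintro ⟨k, hk⟩
    rw [← hk, AlgEquiv.commutes, AlgEquiv.commutes]

lemma exists_iff (h : IsKasamiPair S L) (z : F) :
    (∃ k, algebraMap K F k = z) ↔ z - S (L.symm z) = 0 := by
  constructor
  · rintro ⟨k, rfl⟩
    simp
  · intro hz
    refine h.exists_of_eq ?_
    have h3 := congrArg L (sub_eq_zero.1 hz)
    rwa [← h.comm, L.apply_symm_apply] at h3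

lemma card_range_algebraMap :
    Nat.card (LinearMap.range (Algebra.linearMap K F)) = Nat.card K :=
  (Nat.card_congr (LinearEquiv.ofInjective (Algebra.linearMap K F)
    (algebraMap K F).injective).toEquiv).symm

lemma range_algebraMap_le_ker (h : IsKasamiPair S L) {b : F} (hb : S b = b) :
    LinearMap.range (Algebra.linearMap K F) ≤ LinearMap.ker (radMap S L (-(b + L.symm b)) b) := by
  rintro _ ⟨k, rfl⟩
  rw [h.mem_ker_radMap_iff hb]
  exact ⟨0, by simp⟩

/-- The radical is minimal exactly when `(L⁻¹ b)⁻¹` is not of the form `u - S L⁻¹ u`. -/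
lemma card_ker_eq_iff [Finite F] (h : IsKasamiPair S L) (h2 : (2 : F) ≠ 0) (hKF : Nat.card K < Nat.card F)
    {b : F} (hb : S b = b) :
    Nat.card (LinearMap.ker (radMap S L (-(b + L.symm b)) b)) = Nat.card K
      ↔ ¬ ∃ u, S u = u ∧ u - S (L.symm u) = (L.symm b)⁻¹ := by
  have hLb : S (L.symm b) = L.symm b := by rw [h.comm_symm, hb]
  constructor
  · rintro hc ⟨u, -, hu⟩
    have hle := h.range_algebraMap_le_ker hb
    have heq : LinearMap.range (Algebra.linearMap K F)
        = LinearMap.ker (radMap S L (-(b + L.symm b)) b) := by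
      apply SetLike.coe_injective
      refine Set.eq_of_subset_of_ncard_le hle ?_ (Set.toFinite _)
      exact (hc.trans card_range_algebraMap.symm).le
    by_cases hb0 : b = 0
    · have : Nat.card (LinearMap.ker (radMap S L (-(b + L.symm b)) b)) = Nat.card F := by
        have htop : LinearMap.ker (radMap S L (-(b + L.symm b)) b) = ⊤ := by
          rw [LinearMap.ker_eq_top]
          ext x
          simp [hb0]
        rw [htop]
        exact Nat.card_congr Submodule.topEquiv.toEquiv
      omega
    · have hLb0 : L.symm b ≠ 0 := by simpa using hb0
      have hmem : u ∈ LinearMap.ker (radMap S L (-(b + L.symm b)) b) := by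
        rw [h.mem_ker_radMap_iff hb, hu, mul_inv_cancel₀ hLb0]
        exact ⟨1, map_one _⟩
      rw [← heq] at hmem
      have h0 := (h.exists_iff u).1 hmem
      rw [hu] at h0
      exact inv_ne_zero hLb0 h0
  · intro hu
    rw [← card_range_algebraMap (K := K) (F := F)]
    congr 2
    refine le_antisymm ?_ (h.range_algebraMap_le_ker hb)
    intro z hz
    refine (h.exists_iff z).2 ?_
    by_contra hne
    obtain ⟨k, hk⟩ := (h.mem_ker_radMap_iff hb z).1 hz
    have hLb0 : L.symm b ≠ 0 := by
      intro h0
      exact hu ⟨0, by simp, by simp [h0]⟩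
    have hk0 : algebraMap K F k ≠ 0 := by
      rw [hk]
      exact mul_ne_zero hLb0 hne
    have hz' : z - S (L.symm z) = algebraMap K F k * (L.symm b)⁻¹ := by
      rw [hk]; field_simp
    have hSz : S z - S (S (L.symm z)) = algebraMap K F k * (L.symm b)⁻¹ := by
      have := congrArg S hz'
      rwa [map_sub, map_mul, map_inv₀, hLb, AlgEquiv.commutes] at this
    rw [h.invol] at hSz
    refine hu ⟨algebraMap K F (k⁻¹ * 2⁻¹) * (z + S z), ?_, ?_⟩
    · rw [map_mul, AlgEquiv.commutes, map_add, h.invol, add_comm]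
    · rw [map_mul L.symm, AlgEquiv.commutes, map_mul S, AlgEquiv.commutes, ← mul_sub,
        map_add L.symm, map_add S, h.comm_symm (S z), h.invol,
        show z + S z - (S (L.symm z) + L.symm z) = 2 * (algebraMap K F k * (L.symm b)⁻¹) by
          linear_combination hz' + hSz, map_mul, map_inv₀, map_inv₀, map_ofNat]
      field_simp

/-- The number of `b` fixed by `S` for which the radical containing `1` is minimal. -/
lemma card_fixed_mul [Finite F] (h : IsKasamiPair S L) (h2 : (2 : F) ≠ 0) (hKF : Nat.card K < Nat.card F) :
    Nat.card {b : F // S b = b ∧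
        Nat.card (LinearMap.ker (radMap S L (-(b + L.symm b)) b)) = Nat.card K} * Nat.card K
      + Nat.card {z : F // S z = z} = Nat.card {z : F // S z = z} * Nat.card K := by
  classical
  set U : Submodule K F := LinearMap.ker (S.toLinearMap - LinearMap.id) with hU
  have hmemU : ∀ z, z ∈ U ↔ S z = z := fun z => by
    simp [hU, LinearMap.mem_ker, sub_eq_zero]
  set φ : U →ₗ[K] F := (LinearMap.id - S.toLinearMap ∘ₗ L.symm.toLinearMap).domRestrict U with hφ
  have hφa : ∀ u : U, φ u = u - S (L.symm u) := fun u => rfl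
  have hker : Nat.card (LinearMap.ker φ) = Nat.card K := by
    refine (Nat.card_congr (Equiv.ofBijective
      (fun k : K => (⟨⟨algebraMap K F k, ?_⟩, ?_⟩ : LinearMap.ker φ)) ⟨?_, ?_⟩)).symm
    · rw [hmemU, AlgEquiv.commutes]
    · rw [LinearMap.mem_ker, hφa]
      exact (h.exists_iff _).1 ⟨k, rfl⟩
    · intro k k' hkk
      exact (algebraMap K F).injective (congrArg (fun x : LinearMap.ker φ => ((x : U) : F)) hkk)
    · rintro ⟨⟨u, hu⟩, hu'⟩
      obtain ⟨k, hk⟩ := (h.exists_iff u).2 hu'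
      exact ⟨k, Subtype.ext (Subtype.ext hk)⟩
  have hcardU : Nat.card U = Nat.card {z : F // S z = z} :=
    Nat.card_congr (Equiv.subtypeEquivRight hmemU)
  have hrank : Nat.card (LinearMap.range φ) * Nat.card K = Nat.card {z : F // S z = z} := by
    rw [← hcardU, ← hker, Submodule.card_eq_card_quotient_mul_card (LinearMap.ker φ),
      Nat.card_congr φ.quotKerEquivRange.toEquiv, mul_comm]
  have hbad : Nat.card {b : {z : F // S z = z} // ¬ Nat.card (LinearMap.ker
      (radMap S L (-(b + L.symm b)) (b : F))) = Nat.card K} = Nat.card (LinearMap.range φ) := by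
    refine Nat.card_congr (Equiv.ofBijective (fun b => ⟨(L.symm b.1.1)⁻¹, ?_⟩) ⟨?_, ?_⟩)
    · have := b.2
      rw [h.card_ker_eq_iff h2 hKF b.1.2, not_not] at this
      obtain ⟨u, hu, hu'⟩ := this
      exact ⟨⟨u, (hmemU u).2 hu⟩, hu'⟩
    · rintro ⟨⟨b, hb⟩, hb'⟩ ⟨⟨c, hc⟩, hc'⟩ heq
      have := inv_injective (congrArg Subtype.val heq)
      simpa using this
    · rintro ⟨_, u, rfl⟩
      have hSu : S (φ u) = φ u := by
        rw [hφa, map_sub, (hmemU _).1 u.2, h.invol, h.comm_symm, (hmemU _).1 u.2]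
      have hb : S (L (φ u)⁻¹) = L (φ u)⁻¹ := by rw [h.comm, map_inv₀ S, hSu]
      refine ⟨⟨⟨L (φ u)⁻¹, hb⟩, ?_⟩, ?_⟩
      · rw [h.card_ker_eq_iff h2 hKF hb, not_not]
        exact ⟨u, (hmemU _).1 u.2, by simp [hφa]⟩
      · simp
  have hgood : Nat.card {b : F // S b = b ∧
        Nat.card (LinearMap.ker (radMap S L (-(b + L.symm b)) b)) = Nat.card K}
      = Nat.card {b : {z : F // S z = z} // Nat.card (LinearMap.ker
      (radMap S L (-(b + L.symm b)) (b : F))) = Nat.card K} :=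
    Nat.card_congr (Equiv.subtypeSubtypeEquivSubtypeInter (fun b : F => S b = b)
      (fun b : F => Nat.card (LinearMap.ker (radMap S L (-(b + L.symm b)) b)) = Nat.card K)).symm
  have hsum := Nat.card_congr (Equiv.sumCompl (fun b : {z : F // S z = z} =>
    Nat.card (LinearMap.ker (radMap S L (-(b + L.symm b)) (b : F))) = Nat.card K))
  rw [Nat.card_sum, ← hgood, hbad] at hsum
  rw [← hrank] at hsum ⊢
  rw [← add_mul, hsum]

lemma radMap_mul (x a b y : F) :
    radMap S L (a * (x * S x)) (b * (x * L x)) y = x * radMap S L a b (x * y) := by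
  simp only [radMap_apply, map_mul, L.symm_apply_apply]
  ring

lemma card_ker_radMap_mul {x : F} (hx : x ≠ 0) (a b : F) :
    Nat.card (LinearMap.ker (radMap S L (a * (x * S x)) (b * (x * L x))))
      = Nat.card (LinearMap.ker (radMap S L a b)) := by
  refine Nat.card_congr (Equiv.subtypeEquiv (Equiv.mulLeft₀ x hx) fun y => ?_)
  simp only [LinearMap.mem_ker, radMap_mul, mul_eq_zero, hx, false_or,
    Equiv.mulLeft₀_apply]

/-- The number of `b` for which the radical is minimal and contains `1` equals the number of pairs
`(a, b)` for which it is minimal and contains a given `x ≠ 0`. -/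
lemma card_mem_ker (h : IsKasamiPair S L) (h2 : (2 : F) ≠ 0) {x : F} (hx : x ≠ 0) :
    Nat.card {t : F × F // (S t.1 = t.1 ∧
        Nat.card (LinearMap.ker (radMap S L t.1 t.2)) = Nat.card K) ∧ radMap S L t.1 t.2 x = 0}
      = Nat.card {b : F // S b = b ∧
        Nat.card (LinearMap.ker (radMap S L (-(b + L.symm b)) b)) = Nat.card K} := by
  have hSx : S x ≠ 0 := by simpa using hx
  have hLx : L x ≠ 0 := by simpa using hx
  have hxS : S (x * S x) = x * S x := by rw [map_mul, h.invol, mul_comm]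
  have hrad : ∀ a b, radMap S L a b x = 0 ↔ radMap S L (a * (x * S x)) (b * (x * L x)) 1 = 0 := by
    intro a b
    rw [radMap_mul, mul_one, mul_eq_zero, or_iff_right hx]
  have hone : ∀ a b, radMap S L a b 1 = 0 ↔ a = -(b + L.symm b) := by
    intro a b
    simp only [radMap_apply, map_one, mul_one]
    constructor <;> intro h <;> linear_combination h
  refine Nat.card_congr (Equiv.ofBijective (fun t => ⟨t.1.2 * (x * L x), ?_⟩) ⟨?_, ?_⟩)
  · obtain ⟨⟨a, b⟩, ⟨ha, hc⟩, hr⟩ := t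
    dsimp only at ha hc hr ⊢
    rw [hrad] at hr
    have hb := h.fixed_of_one_mem h2 (by rw [map_mul, hxS, ha]) hr
    rw [hone] at hr
    exact ⟨hb, by rw [← hr, card_ker_radMap_mul hx, hc]⟩
  · rintro ⟨⟨a, b⟩, ⟨ha, hc⟩, hr⟩ ⟨⟨a', b'⟩, ⟨ha', hc'⟩, hr'⟩ heq
    have hb : b = b' := mul_right_cancel₀ (mul_ne_zero hx hLx) (congrArg Subtype.val heq)
    subst hb
    dsimp only at hr hr'
    rw [hrad, hone] at hr hr'
    have hab : a = a' := mul_right_cancel₀ (mul_ne_zero hx hSx) (hr.trans hr'.symm)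
    subst hab
    rfl
  · rintro ⟨b, hb, hc⟩
    have hb' : b / (x * L x) * (x * L x) = b := div_mul_cancel₀ _ (mul_ne_zero hx hLx)
    have ha' : -(b + L.symm b) / (x * S x) * (x * S x) = -(b + L.symm b) :=
      div_mul_cancel₀ _ (mul_ne_zero hx hSx)
    refine ⟨⟨(-(b + L.symm b) / (x * S x), b / (x * L x)), ⟨?_, ?_⟩, ?_⟩, Subtype.ext hb'⟩
    · rw [map_div₀, hxS, map_neg, map_add, h.comm_symm, hb]
    · rw [← card_ker_radMap_mul hx, ha', hb', hc]
    · rw [hrad, ha', hb', hone]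

/-- The number of pairs `(a, b)` for which the radical is as small as possible. -/
lemma card_minimal_radical (h : IsKasamiPair S L) (h2 : (2 : F) ≠ 0) [Fintype F]
    (hKF : Nat.card K < Nat.card F) (hK : 1 < Nat.card K) :
    Nat.card {t : F × F // S t.1 = t.1 ∧
        Nat.card (LinearMap.ker (radMap S L t.1 t.2)) = Nat.card K} * Nat.card K
      = (Nat.card F - 1) * Nat.card {z : F // S z = z} := by
  classical
  set X : Finset (F × F) := univ.filter fun t => S t.1 = t.1 ∧
        Nat.card (LinearMap.ker (radMap S L t.1 t.2)) = Nat.card K with hX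
  have hXc : Nat.card {t : F × F // S t.1 = t.1 ∧
        Nat.card (LinearMap.ker (radMap S L t.1 t.2)) = Nat.card K} = X.card := by
    rw [Nat.card_eq_fintype_card, Fintype.card_subtype]
  have hdc := sum_card_bipartiteAbove_eq_sum_card_bipartiteBelow
    (s := X) (t := (univ : Finset F).erase 0) (fun t x => radMap S L t.1 t.2 x = 0)
  have habove : ∀ t ∈ X, (((univ : Finset F).erase 0).bipartiteAbove
      (fun t x => radMap S L t.1 t.2 x = 0) t).card = Nat.card K - 1 := by
    intro t ht
    rw [← (mem_filter.1 ht).2.2, Nat.card_eq_fintype_card, Fintype.card_subtype,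
      ← card_erase_of_mem (a := 0) (by simp)]
    congr 1
    ext x
    simp [bipartiteAbove]
  have hbelow : ∀ x ∈ (univ : Finset F).erase 0, (X.bipartiteBelow
      (fun t x => radMap S L t.1 t.2 x = 0) x).card = Nat.card {b : F // S b = b ∧
        Nat.card (LinearMap.ker (radMap S L (-(b + L.symm b)) b)) = Nat.card K} := by
    intro x hx
    rw [← h.card_mem_ker h2 (mem_erase.1 hx).1, Nat.card_eq_fintype_card, Fintype.card_subtype,
      bipartiteBelow, hX, filter_filter]
  rw [sum_congr rfl habove, sum_congr rfl hbelow, sum_const, sum_const, smul_eq_mul, smul_eq_mul,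
    card_erase_of_mem (mem_univ _), card_univ, ← Nat.card_eq_fintype_card (α := F)] at hdc
  have hfix := h.card_fixed_mul h2 hKF
  rw [hXc]
  obtain ⟨k, hk⟩ : ∃ k, Nat.card K = k + 1 := ⟨Nat.card K - 1, by omega⟩
  have hk0 : 0 < k := by omega
  rw [hk, Nat.add_sub_cancel] at hdc
  simp only [hk] at hfix hdc ⊢
  apply Nat.eq_of_mul_eq_mul_right hk0
  linear_combination (k + 1) * hdc + (Nat.card F - 1) * hfix

end IsKasamiPair

end RadicalCount

section FiniteFields

lemma ringChar_ne_two_of_two_ne_zero {K : Type*} [Field K] (h2 : (2 : K) ≠ 0) :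
    ringChar K ≠ 2 := fun h => h2 <| by
  have := ringChar.Nat.cast_ringChar (R := K)
  rw [h] at this
  exact_mod_cast this

/-- An element of an extension of a finite field `K` with `|K|` elements that satisfies
`z ^ |K| = z` lies in `K`. -/
lemma exists_algebraMap_eq_of_pow_card_eq {K F : Type*} [Field K] [Fintype K] [Field F]
    [Algebra K F] {z : F} (hz : z ^ Fintype.card K = z) : ∃ k, algebraMap K F k = z := by
  classical
  by_contra! hne
  have hK : 1 < Fintype.card K := Fintype.one_lt_card
  have hP := FiniteField.X_pow_card_sub_X_ne_zero F hK
  have hsub : (insert z (univ.image (algebraMap K F))).val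
      ⊆ (Polynomial.X ^ Fintype.card K - Polynomial.X : Polynomial F).roots := by
    intro y hy
    rw [Polynomial.mem_roots hP, Polynomial.IsRoot, Polynomial.eval_sub, Polynomial.eval_pow,
      Polynomial.eval_X, sub_eq_zero]
    rcases Finset.mem_insert.1 (Finset.mem_def.2 hy) with rfl | hy
    · exact hz
    · obtain ⟨k, -, rfl⟩ := mem_image.1 hy
      rw [← map_pow, FiniteField.pow_card]
  have hle := Polynomial.card_le_degree_of_subset_roots hsub
  rw [FiniteField.X_pow_card_sub_X_natDegree_eq F hK, card_insert_of_notMem (by simpa using hne),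
    card_image_of_injective _ (algebraMap K F).injective, card_univ] at hle
  omega

lemma card_pow_eq_self {K F : Type*} [Field K] [Fintype K] [Field F] [Algebra K F] :
    Nat.card {z : F // z ^ Fintype.card K = z} = Fintype.card K := by
  refine Eq.trans ?_ Nat.card_eq_fintype_card
  refine (Nat.card_congr (Equiv.ofBijective
    (fun k : K => (⟨algebraMap K F k, ?_⟩ : {z : F // z ^ Fintype.card K = z})) ⟨?_, ?_⟩)).symm
  · rw [← map_pow, FiniteField.pow_card]
  · intro k k' h
    exact (algebraMap K F).injective (congrArg Subtype.val h)
  · rintro ⟨z, hz⟩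
    obtain ⟨k, hk⟩ := exists_algebraMap_eq_of_pow_card_eq hz
    exact ⟨k, Subtype.ext hk⟩

lemma pow_pow_gcd_eq_self {F : Type*} [Monoid F] {p m n : ℕ} {z : F} (hm : z ^ p ^ m = z)
    (hn : z ^ p ^ n = z) : z ^ p ^ Nat.gcd m n = z := by
  have key : ∀ k, Function.IsPeriodicPt (fun x : F => x ^ p) k z ↔ z ^ p ^ k = z := fun k => by
    rw [Function.IsPeriodicPt, Function.IsFixedPt, pow_iterate]
  exact (key _).1 (((key m).2 hm).gcd ((key n).2 hn))

/-- Elements of the prime field are squares in extensions of even degree. -/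
lemma isSquare_algebraMap_zmod {p : ℕ} [Fact p.Prime] (hodd : Odd p) {K : Type*} [Field K]
    [Fintype K] [Algebra (ZMod p) K] {d : ℕ} (hd : Even d) (hK : Fintype.card K = p ^ d)
    (h2 : ringChar K ≠ 2) (t : ZMod p) : IsSquare (algebraMap (ZMod p) K t) := by
  by_cases ht : t = 0
  · exact ⟨0, by simp [ht]⟩
  rw [FiniteField.isSquare_iff h2 (by simpa using ht), hK]
  obtain ⟨e, rfl⟩ := hd
  obtain ⟨w, hw⟩ : p - 1 ∣ p ^ e - 1 := by simpa using Nat.sub_dvd_pow_sub_pow p 1 e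
  obtain ⟨v, hv⟩ : Odd (p ^ e) := hodd.pow
  have h3 : p ^ (e + e) / 2 = (p - 1) * (w * (v + 1)) := by
    have h4 : p ^ e = (p - 1) * w + 1 := by omega
    have h5 : p ^ (e + e) = 2 * ((p - 1) * (w * (v + 1))) + 1 := by
      have h6 : 2 * v = (p - 1) * w := by omega
      have h7 : p ^ (e + e) = ((p - 1) * w + 1) * (2 * v + 1) := by rw [← h4, ← hv, pow_add]
      linear_combination h7 + h6
    omega
  rw [h3, pow_mul, ← map_pow, ZMod.pow_card_sub_one_eq_one ht, map_one, one_pow]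

end FiniteFields

section KasamiForms

variable {K F : Type*} [Field K] [Field F] [Algebra K F]

/-- The quadratic form `x ↦ Tr (a / 2 * x * S x + b * x * L x)`. -/
noncomputable def kasamiForm (S L : F ≃ₐ[K] F) (a b : F) : QuadraticForm K F :=
  LinearMap.BilinMap.toQuadraticMap (LinearMap.mk₂ K
    (fun x y => Algebra.trace K F (a / 2 * (x * S y) + b * (x * L y)))
    (fun x x' y => by rw [← map_add]; congr 1; ring)
    (fun k x y => by rw [← map_smul]; congr 1; simp only [Algebra.smul_def]; ring)
    (fun x y y' => by rw [← map_add]; congr 1; simp only [map_add]; ring)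
    (fun k x y => by
      rw [← map_smul]; congr 1; simp only [Algebra.smul_def, map_mul, AlgEquiv.commutes]; ring))

lemma kasamiForm_apply (S L : F ≃ₐ[K] F) (a b x : F) :
    kasamiForm S L a b x = Algebra.trace K F (a / 2 * (x * S x) + b * (x * L x)) := rfl

lemma smul_kasamiForm (S L : F ≃ₐ[K] F) (k : K) (a b : F) :
    k • kasamiForm S L a b = kasamiForm S L (algebraMap K F k * a) (algebraMap K F k * b) := by
  ext x
  rw [smul_apply, kasamiForm_apply, kasamiForm_apply, ← map_smul]
  congr 1
  rw [Algebra.smul_def]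
  ring

lemma polarBilin_kasamiForm {S : F ≃ₐ[K] F} (hS : ∀ z, S (S z) = z) (L : F ≃ₐ[K] F)
    (h2 : (2 : F) ≠ 0) {a : F} (ha : S a = a) (b x : F) :
    (kasamiForm S L a b).polarBilin x = Algebra.traceForm K F (radMap S L a b x) := by
  ext y
  have h1 : Algebra.trace K F (a / 2 * (x * S y)) = Algebra.trace K F (a / 2 * (y * S x)) := by
    rw [← Algebra.trace_eq_of_algEquiv S (a / 2 * (x * S y))]
    congr 1
    rw [map_mul, map_mul, map_div₀, map_ofNat, ha, hS]
    ring
  have h3 : Algebra.trace K F (b * (x * L y)) = Algebra.trace K F (L.symm (b * x) * y) := by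
    rw [← Algebra.trace_eq_of_algEquiv L (L.symm (b * x) * y)]
    congr 1
    rw [map_mul, AlgEquiv.apply_symm_apply]
    ring
  rw [kasamiForm, LinearMap.BilinMap.polarBilin_toQuadraticMap]
  simp only [LinearMap.add_apply, LinearMap.flip_apply, LinearMap.mk₂_apply,
    Algebra.traceForm_apply, radMap_apply]
  rw [map_add, h1, h3, ← map_add, ← map_add]
  congr 1
  field_simp
  ring

lemma ker_polarBilin_kasamiForm [FiniteDimensional K F] [Algebra.IsSeparable K F] {S : F ≃ₐ[K] F}
    (hS : ∀ z, S (S z) = z) (L : F ≃ₐ[K] F)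
    (h2 : (2 : F) ≠ 0) {a : F} (ha : S a = a) (b : F) :
    LinearMap.ker (kasamiForm S L a b).polarBilin = LinearMap.ker (radMap S L a b) := by
  ext x
  rw [LinearMap.mem_ker, LinearMap.mem_ker, polarBilin_kasamiForm hS L h2 ha]
  exact ⟨fun h => (traceForm_nondegenerate K F).1 _ fun y => by rw [h]; rfl,
    fun h => by rw [h, map_zero]⟩

end KasamiForms

section KasamiCount

variable {K F : Type*} [Field K] [Fintype K] [Field F] [Fintype F] [Algebra K F]
  {S L : F ≃ₐ[K] F} {ψ : AddChar K ℂ}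

lemma quadExpSum_kasamiForm_sq (hS : ∀ z, S (S z) = z) (hψ : ψ ≠ 1) (h2 : (2 : K) ≠ 0)
    (hi : IsSquare (-1 : K)) {a : F} (ha : S a = a) (b : F) :
    quadExpSum ψ (kasamiForm S L a b) ^ 2
      = Fintype.card F * Nat.card (LinearMap.ker (radMap S L a b)) := by
  have h2' : (2 : F) ≠ 0 := by
    rw [← map_ofNat (algebraMap K F) 2]
    exact (map_ne_zero _).2 h2
  rw [quadExpSum_sq hψ h2 hi, ker_polarBilin_kasamiForm hS L h2' ha]

lemma card_ker_of_quadExpSum_eq (hS : ∀ z, S (S z) = z) (hψ : ψ ≠ 1) (h2 : (2 : K) ≠ 0)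
    (hi : IsSquare (-1 : K)) {σ : ℂ} (hσ : σ ^ 2 = Fintype.card F * Fintype.card K) {a : F}
    (ha : S a = a) (b : F) :
    Nat.card (LinearMap.ker (radMap S L a b)) = Nat.card K ↔
      quadExpSum ψ (kasamiForm S L a b) = σ ∨ quadExpSum ψ (kasamiForm S L a b) = -σ := by
  rw [← sq_eq_sq_iff_eq_or_eq_neg, quadExpSum_kasamiForm_sq hS hψ h2 hi ha, hσ,
    Nat.card_eq_fintype_card (α := K)]
  have : (Fintype.card F : ℂ) ≠ 0 := by simp
  rw [mul_right_inj' this, Nat.cast_inj]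

lemma IsKasamiPair.card_quadExpSum_eq (h : IsKasamiPair S L) (hψ : ψ ≠ 1) (h2 : (2 : K) ≠ 0)
    (hi : IsSquare (-1 : K)) (hn : Even (Module.finrank K F)) {σ : ℂ}
    (hσ : σ ^ 2 = Fintype.card F * Fintype.card K) :
    2 * Nat.card {t : F × F // S t.1 = t.1 ∧ quadExpSum ψ (kasamiForm S L t.1 t.2) = σ}
      * Fintype.card K = (Fintype.card F - 1) * Nat.card {z : F // S z = z} := by
  classical
  have h2' : (2 : F) ≠ 0 := by
    rw [← map_ofNat (algebraMap K F) 2]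
    exact (map_ne_zero _).2 h2
  have hKF : Nat.card K < Nat.card F := by
    rw [Module.natCard_eq_pow_finrank (K := K) (V := F)]
    have h1 : 0 < Module.finrank K F := Module.finrank_pos
    obtain ⟨r, hr⟩ := hn
    exact lt_self_pow₀ Finite.one_lt_card (by omega)
  have hmain := h.card_minimal_radical h2' hKF Finite.one_lt_card
  rw [Nat.card_eq_fintype_card (α := K), Nat.card_eq_fintype_card (α := F)] at hmain
  rw [← hmain]
  congr 1
  have hσ0 : σ ≠ 0 := by
    rintro rfl
    simp at hσ
  set A : ℂ → Finset (F × F) := fun τ => univ.filter fun t =>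
    S t.1 = t.1 ∧ quadExpSum ψ (kasamiForm S L t.1 t.2) = τ with hA
  have hneg : ∀ τ : ℂ, τ ^ 2 = Fintype.card F * Fintype.card K → (A τ).card ≤ (A (-τ)).card := by
    intro τ hτ
    obtain ⟨c, hc⟩ := FiniteField.exists_nonsquare (ringChar_ne_two_of_two_ne_zero h2)
    have hc0 : algebraMap K F c ≠ 0 := (map_ne_zero _).2 fun h0 => hc (h0 ▸ IsSquare.zero)
    refine card_le_card_of_injOn (fun t => (algebraMap K F c * t.1, algebraMap K F c * t.2)) ?_ ?_
    · intro t ht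
      obtain ⟨-, h3, h4⟩ := mem_filter.1 (mem_coe.1 ht)
      refine mem_coe.2 (mem_filter.2 ⟨mem_univ _, by simp [h3], ?_⟩)
      rw [← smul_kasamiForm, quadExpSum_nonsquare_smul hψ h2 hi hc _ hn, h4]
      rw [ker_polarBilin_kasamiForm h.invol L h2' h3, ← Nat.card_eq_fintype_card]
      exact (card_ker_of_quadExpSum_eq h.invol hψ h2 hi hτ h3 _).2 (Or.inl h4)
    · rintro ⟨x, y⟩ - ⟨x', y'⟩ - hxy
      simpa [hc0] using hxy
  have heq : (A σ).card = (A (-σ)).card :=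
    le_antisymm (hneg σ hσ) (by simpa using hneg (-σ) (by simpa using hσ))
  have hdisj : Disjoint (A σ) (A (-σ)) := by
    rw [disjoint_left]
    intro t h3 h4
    have h5 := (mem_filter.1 h3).2.2.symm.trans (mem_filter.1 h4).2.2
    exact hσ0 (self_eq_neg.1 h5)
  have hunion : A σ ∪ A (-σ) = univ.filter fun t => S t.1 = t.1 ∧
      Nat.card (LinearMap.ker (radMap S L t.1 t.2)) = Nat.card K := by
    ext t
    simp only [hA, mem_union, mem_filter, mem_univ, true_and, ← and_or_left]
    exact and_congr_right fun h3 => (card_ker_of_quadExpSum_eq h.invol hψ h2 hi hσ h3 _).symm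
  have hcard := card_union_of_disjoint hdisj
  rw [hunion, ← heq] at hcard
  rw [Nat.card_eq_fintype_card, Nat.card_eq_fintype_card, Fintype.card_subtype,
    Fintype.card_subtype, ← Nat.card_eq_fintype_card (α := K), hcard, two_mul]

end KasamiCount

section WeightCount

variable {p : ℕ} [Fact p.Prime] {K F : Type*} [Field K] [Fintype K] [Field F] [Fintype F]
  [Algebra K F] [Algebra (ZMod p) K] {S L : F ≃ₐ[K] F}

lemma ne_neg_mul_of_sq_eq (hodd : Odd p) {q r k : ℕ} (hq : q ≠ 0) {T τ : ℂ}
    (hT : T ^ 2 = q * (p ^ r : ℕ)) (hτ : τ ^ 2 = q * (p ^ k : ℕ)) : T ≠ -((p - 1) * τ) := by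
  intro h
  have hp := (Fact.out : p.Prime)
  have h1 : (q : ℂ) * (p ^ r : ℕ) = q * ((p - 1 : ℕ) ^ 2 * (p ^ k : ℕ) : ℕ) := by
    rw [← hT, h, neg_sq, mul_pow, hτ]
    push_cast [Nat.cast_sub hp.one_le]
    ring
  rw [mul_right_inj' (by exact_mod_cast hq), Nat.cast_inj] at h1
  have h2 : p - 1 ∣ p ^ r := ⟨(p - 1) * p ^ k, by rw [h1]; ring⟩
  have h3 : Nat.Coprime (p - 1) (p ^ r) := by
    apply Nat.Coprime.pow_right
    have := (Nat.coprime_self_add_right (m := p - 1) (n := 1)).2 (Nat.coprime_one_right _)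
    rwa [Nat.sub_add_cancel hp.one_le] at this
  have h4 := Nat.eq_one_of_dvd_coprimes h3 dvd_rfl h2
  obtain ⟨m, hm⟩ := hodd
  have := hp.one_lt
  omega

/-- The functional `x ↦ Tr (c * x)`. -/
noncomputable def traceDual (K F : Type*) [Field K] [Field F] [Algebra K F]
    [FiniteDimensional K F] [Algebra.IsSeparable K F] : F ≃ₗ[K] Module.Dual K F :=
  LinearMap.BilinForm.toDual (Algebra.traceForm K F) (traceForm_nondegenerate K F)

lemma traceDual_apply (c x : F) : traceDual K F c x = Algebra.trace K F (c * x) := rfl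

lemma IsKasamiPair.card_zeroCount_eq (h : IsKasamiPair S L) (hodd : Odd p)
    {e : AddChar (ZMod p) ℂ} (he : e ≠ 1) {θ : K →ₗ[ZMod p] ZMod p} (hθ : θ ≠ 0)
    (h2 : (2 : K) ≠ 0) (hsq : ∀ t : ZMod p, IsSquare (algebraMap (ZMod p) K t))
    (hn : Even (Module.finrank K F)) {τ : ℂ}
    (hτ : τ ^ 2 = Fintype.card F * Fintype.card K) :
    2 * Nat.card {t : F × F × F × ZMod p // S t.1 = t.1 ∧
        (p : ℂ) * zeroCount θ (kasamiForm S L t.1 t.2.1) (traceDual K F t.2.2.1) t.2.2.2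
          = Fintype.card F + (p - 1) * τ} * Fintype.card K ^ 2
      = (Fintype.card F - 1) * Nat.card {z : F // S z = z} * Fintype.card F := by
  classical
  have hψ := compLinearChar_ne_one he hθ
  have hi : IsSquare (-1 : K) := by simpa using hsq (-1)
  have h2' : (2 : F) ≠ 0 := by
    rw [← map_ofNat (algebraMap K F) 2]
    exact (map_ne_zero _).2 h2
  have hτ0 : τ ≠ 0 := by
    rintro rfl
    simp at hτ
  have hA := h.card_quadExpSum_eq hψ h2 hi hn hτ
  set X : Finset (F × F × F × ZMod p) := univ.filter fun t => S t.1 = t.1 ∧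
        (p : ℂ) * zeroCount θ (kasamiForm S L t.1 t.2.1) (traceDual K F t.2.2.1) t.2.2.2
          = Fintype.card F + (p - 1) * τ with hX
  set A : Finset (F × F) := univ.filter fun t =>
    S t.1 = t.1 ∧ quadExpSum (compLinearChar e θ) (kasamiForm S L t.1 t.2) = τ with hAdef
  rw [Nat.card_eq_fintype_card, Fintype.card_subtype, ← hAdef] at hA
  rw [Nat.card_eq_fintype_card, Fintype.card_subtype, ← hX]
  have hmaps : ∀ t ∈ X, (t.1, t.2.1) ∈ A := by
    intro t ht
    obtain ⟨-, hS, hz⟩ := mem_filter.1 ht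
    refine mem_filter.2 ⟨mem_univ _, hS, quadExpSum_eq_of_mul_zeroCount_eq he hθ h2 hsq _ hτ0 ?_ hz⟩
    have : CharP K p := charP_of_injective_algebraMap (algebraMap (ZMod p) K).injective p
    obtain ⟨k, -, hk⟩ := FiniteField.card K p
    refine ne_neg_mul_of_sq_eq hodd (Fintype.card_ne_zero (α := F)) (k := k)
      (r := k * Module.finrank K (LinearMap.ker (radMap S L t.1 t.2.1))) ?_ (by rw [hτ, hk])
    rw [quadExpSum_kasamiForm_sq h.invol hψ h2 hi hS, pow_mul, ← hk,
      Module.natCard_eq_pow_finrank (K := K), Nat.card_eq_fintype_card]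
  have hfib : ∀ u ∈ A, (X.filter fun t => (t.1, t.2.1) = u).card * Fintype.card K
      = Fintype.card F := by
    rintro ⟨a, b⟩ hu
    obtain ⟨-, hS, hT⟩ := mem_filter.1 hu
    have hker := (card_ker_of_quadExpSum_eq h.invol hψ h2 hi hτ hS b).2 (Or.inl hT)
    have hc := card_zeroCount_eq_mul_card_ker he hθ h2 hsq _ hτ0 hT
    rw [ker_polarBilin_kasamiForm h.invol L h2' hS, hker, Nat.card_eq_fintype_card (α := K)] at hc
    rw [← hc]
    congr 1
    rw [← Fintype.card_coe, ← Nat.card_eq_fintype_card]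
    refine Nat.card_congr
      { toFun := fun t => ⟨(traceDual K F t.1.2.2.1, t.1.2.2.2), ?_⟩
        invFun := fun t => ⟨(a, b, (traceDual K F).symm t.1.1, t.1.2), ?_⟩
        left_inv := ?_
        right_inv := ?_ }
    · obtain ⟨⟨x, y, z, w⟩, ht⟩ := t
      obtain ⟨hx, hxy⟩ := mem_filter.1 ht
      obtain ⟨rfl, rfl⟩ := Prod.mk.inj hxy
      exact (mem_filter.1 hx).2.2
    · exact mem_filter.2 ⟨mem_filter.2 ⟨mem_univ _, hS, by simpa using t.2⟩, rfl⟩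
    · rintro ⟨⟨x, y, z, w⟩, ht⟩
      obtain ⟨rfl, rfl⟩ := Prod.mk.inj (mem_filter.1 ht).2
      simp
    · rintro ⟨⟨f, w⟩, ht⟩
      simp
  have hXA : X.card * Fintype.card K = A.card * Fintype.card F := by
    rw [card_eq_sum_card_fiberwise (s := X) (f := fun t => (t.1, t.2.1)) (t := A)
      fun t ht => hmaps t ht, sum_mul,
      sum_congr rfl hfib, sum_const, smul_eq_mul]
  linear_combination 2 * Fintype.card K * hXA + Fintype.card F * hA

end WeightCount

section Codewords

lemma trp_two_mul {p s : ℕ} {F : Type} [Field F] {z : F} (hz : z ^ p ^ s = z) :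
    trp p (2 * s) z = 2 * trp p s z := by
  rw [trp, two_mul, sum_range_add, trp, two_mul]
  simp_rw [pow_add, pow_mul, hz]

lemma trp_eq_algebraMap_trace {p n : ℕ} [Fact p.Prime] {F : Type} [Field F] [Fintype F]
    [Algebra (ZMod p) F] (hF : Fintype.card F = p ^ n) (z : F) :
    trp p n z = algebraMap (ZMod p) F (Algebra.trace (ZMod p) F z) := by
  rw [FiniteField.algebraMap_trace_eq_sum_pow, Nat.card_zmod, trp]
  have h := Module.card_eq_pow_finrank (K := ZMod p) (V := F)
  rw [hF, ZMod.card] at h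
  rw [Nat.pow_right_injective (Fact.out : p.Prime).two_le h]

variable {p s l : ℕ} [Fact p.Prime] {F : Type} [Field F] [Fintype F] [Algebra (ZMod p) F]
  {K : Type*} [Field K] [Fintype K] [Algebra (ZMod p) K] [Algebra K F]
  [IsScalarTower (ZMod p) K F] {S L : F ≃ₐ[K] F}

lemma cword_eq (hF : Fintype.card F = p ^ (2 * s)) (h2 : (2 : F) ≠ 0)
    (hS : ∀ z, S z = z ^ p ^ s) (hL : ∀ z, L z = z ^ p ^ l) {a : F} (ha : S a = a) (b c : F)
    (h : ZMod p) (x : F) :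
    cword p s l a b c h x = algebraMap (ZMod p) F
      (Algebra.trace (ZMod p) K (kasamiForm S L a b x + traceDual K F c x) + h) := by
  have hw : (a * x ^ (p ^ s + 1)) ^ p ^ s = a * x ^ (p ^ s + 1) := by
    have hx : (x ^ p ^ s) ^ p ^ s = x := by
      rw [← pow_mul, ← pow_add, ← two_mul, ← hF, FiniteField.pow_card]
    rw [mul_pow, ← hS a, ha, pow_succ, mul_pow, hx, mul_comm x]
  have h3 : trp p s (a * x ^ (p ^ s + 1)) = trp p (2 * s) (a / 2 * (x * S x)) := by
    apply mul_left_cancel₀ h2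
    rw [← trp_two_mul hw, trp_eq_algebraMap_trace hF, trp_eq_algebraMap_trace hF, two_mul,
      ← map_add, ← map_add, hS]
    congr 2
    field_simp
    ring
  have hcast : (ZMod.cast h : F) = algebraMap (ZMod p) F h := by
    have : CharP F p := charP_of_injective_algebraMap (algebraMap (ZMod p) F).injective p
    rw [← ZMod.castHom_apply (h := dvd_rfl)]
    exact congrFun (congrArg _ (Subsingleton.elim _ _)) h
  rw [cword, h3, trp_eq_algebraMap_trace hF, trp_eq_algebraMap_trace hF, hcast, ← map_add,
    ← map_add, ← map_add, kasamiForm_apply, traceDual_apply, ← map_add (Algebra.trace K F),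
    Algebra.trace_trace]
  congr 3
  rw [hL]
  ring

lemma card_suppw_add_zeroCount [DecidableEq F] (hF : Fintype.card F = p ^ (2 * s))
    (h2 : (2 : F) ≠ 0)
    (hS : ∀ z, S z = z ^ p ^ s) (hL : ∀ z, L z = z ^ p ^ l) {a : F} (ha : S a = a) (b c : F)
    (h : ZMod p) :
    (suppw p s l a b c h).card
      + zeroCount (Algebra.trace (ZMod p) K) (kasamiForm S L a b) (traceDual K F c) h
      = p ^ (2 * s) := by
  classical
  rw [← hF, ← card_univ, zeroCount, add_comm, suppw,
    ← card_filter_add_card_filter_not (s := univ) fun x => cword p s l a b c h x = 0]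
  congr 2
  ext x
  rw [mem_filter, mem_filter, cword_eq hF h2 hS hL ha, map_eq_zero]

lemma weight_eq_iff_zeroCount {p s d w n : ℕ} (hp : p ≠ 0) (hs : 1 ≤ s) (hd : Even d)
    (hds : d ≤ s) (hwn : w + n = p ^ (2 * s)) (ε : ℤ) :
    (w : ℤ) = (p : ℤ) ^ (s + d / 2 - 1) * ((p : ℤ) - 1) * ((p : ℤ) ^ (s - d / 2) + ε) ↔
      (p : ℂ) * n = (p ^ (2 * s) : ℕ) + (p - 1) * (-(ε * p ^ (s + d / 2))) := by
  obtain ⟨e, rfl⟩ := hd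
  obtain ⟨r, rfl⟩ : ∃ r, s = r + e := ⟨s - e, by omega⟩
  have he : (e + e) / 2 = e := by omega
  obtain ⟨t, ht⟩ : ∃ t, r + e + e = t + 1 := ⟨r + e + e - 1, by omega⟩
  have h2s : 2 * (r + e) = t + 1 + r := by omega
  have hp' : (p : ℤ) ≠ 0 := by exact_mod_cast hp
  rw [he, ht, Nat.add_sub_cancel, Nat.add_sub_cancel, h2s]
  rw [h2s] at hwn
  have hwn' : (w : ℤ) = p ^ (t + 1 + r) - n := by
    rw [eq_sub_iff_add_eq]
    exact_mod_cast hwn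
  have hcast : (p : ℂ) * n = (p ^ (t + 1 + r) : ℕ) + (p - 1) * (-(ε * p ^ (t + 1))) ↔
      (p : ℤ) * n = p ^ (t + 1 + r) + (p - 1) * (-(ε * p ^ (t + 1))) := by
    exact_mod_cast Iff.rfl
  rw [hcast, hwn', ← mul_right_inj' hp']
  constructor <;> intro h <;> linear_combination -h

end Codewords

lemma GaloisField.card_eq_pow (p : ℕ) [Fact p.Prime] {n : ℕ} (hn : n ≠ 0)
    [Fintype (GaloisField p n)] : Fintype.card (GaloisField p n) = p ^ n := by
  rw [← Nat.card_eq_fintype_card, GaloisField.card p n hn]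

lemma nonempty_algHom_galoisField {p n m : ℕ} [Fact p.Prime] {F : Type} [Field F] [Fintype F]
    [Algebra (ZMod p) F] (hF : Fintype.card F = p ^ m) (hn : n ≠ 0) (hnm : n ∣ m) :
    Nonempty (GaloisField p n →ₐ[ZMod p] F) := by
  apply FiniteField.nonempty_algHom_of_finrank_dvd
  have h := Module.card_eq_pow_finrank (K := ZMod p) (V := F)
  rw [hF, ZMod.card] at h
  rwa [GaloisField.finrank p hn, ← Nat.pow_right_injective (Fact.out : p.Prime).two_le h]

lemma two_ne_zero_of_odd_prime {p : ℕ} [Fact p.Prime] (hodd : Odd p) {K : Type*} [Field K]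
    [Algebra (ZMod p) K] : (2 : K) ≠ 0 := by
  rw [← map_ofNat (algebraMap (ZMod p) K) 2]
  refine (map_ne_zero _).2 fun h => ?_
  have h1 : p ∣ 2 := (ZMod.natCast_eq_zero_iff 2 p).1 (by exact_mod_cast h)
  have := Nat.le_of_dvd two_pos h1
  have := (Fact.out : p.Prime).two_le
  obtain rfl : p = 2 := by omega
  exact absurd hodd (by decide)

/-- The iterated Frobenius `z ↦ z ^ p ^ n` is `K`-linear when `|K| = p ^ d` and `d ∣ n`. -/
lemma exists_algEquiv_eq_pow {p d n : ℕ} {K F : Type*} [Field K] [Fintype K] [Field F]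
    [Fintype F] [Algebra K F] (hK : Fintype.card K = p ^ d) (hn : d ∣ n) :
    ∃ S : F ≃ₐ[K] F, ∀ z, S z = z ^ p ^ n := by
  obtain ⟨k, rfl⟩ := hn
  refine ⟨FiniteField.frobeniusAlgEquivOfAlgebraic K F ^ k, fun z => ?_⟩
  rw [AlgEquiv.coe_pow, FiniteField.coe_frobeniusAlgEquivOfAlgebraic_iterate,
    hK, ← pow_mul]

theorem stmt9 (p s l : ℕ) [Fact p.Prime] (F : Type) [Field F] [Fintype F] [DecidableEq F]
    [CharP F p] (hodd : Odd p) (hs : 2 ≤ s) (hl1 : 1 ≤ l) (hls : l ≠ s)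
    (hl2 : l ≤ 2 * s - 1) (hF : Fintype.card F = p ^ (2 * s)) (d : ℕ)
    (hd : Nat.gcd s l = d) (hd' : Nat.gcd (s + l) (2 * l) = d) (hdeven : Even d) :
    ∀ ε : ℤ, ε = 1 ∨ ε = -1 →
      (((Finset.univ : Finset (F × F × F × ZMod p)).filter fun t =>
        t.1 ^ p ^ s = t.1 ∧ ((suppw p s l t.1 t.2.1 t.2.2.1 t.2.2.2).card : ℤ)
          = (p : ℤ) ^ (s + d / 2 - 1) * ((p : ℤ) - 1) * ((p : ℤ) ^ (s - d / 2) + ε)).card : ℚ)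
        = (p : ℚ) ^ (3 * s - 2 * d) * ((p : ℚ) ^ (2 * s) - 1) / 2 := by
  classical
  intro ε hε
  have hp := (Fact.out : p.Prime)
  let _ : Algebra (ZMod p) F := ZMod.algebra F p
  have hd0 : d ≠ 0 := by
    rw [← hd]
    exact (Nat.gcd_pos_of_pos_left l (by omega)).ne'
  have hds : d ∣ s := hd ▸ Nat.gcd_dvd_left s l
  have hdl : d ∣ l := hd ▸ Nat.gcd_dvd_right s l
  have hdle : d ≤ s := Nat.le_of_dvd (by omega) hds
  let K := GaloisField p d
  let _ : Fintype K := Fintype.ofFinite K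
  have hK : Fintype.card K = p ^ d := GaloisField.card_eq_pow p hd0
  obtain ⟨f⟩ := nonempty_algHom_galoisField hF hd0 (hds.mul_left 2)
  let _ : Algebra K F := f.toRingHom.toAlgebra
  have : IsScalarTower (ZMod p) K F := IsScalarTower.of_algebraMap_eq' f.comp_algebraMap.symm
  obtain ⟨S, hS⟩ := exists_algEquiv_eq_pow (F := F) hK hds
  obtain ⟨L, hL⟩ := exists_algEquiv_eq_pow (F := F) hK hdl
  have hpair : IsKasamiPair S L :=
    { invol := fun z => by
        rw [hS, hS, ← pow_mul, ← pow_add, ← two_mul, ← hF, FiniteField.pow_card]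
      comm := fun z => by rw [hS, hL, hL, hS, pow_right_comm]
      fixed := fun z h1 h2 => by
        apply exists_algebraMap_eq_of_pow_card_eq
        rw [hK, ← hd']
        apply pow_pow_gcd_eq_self
        · rwa [hS, hL, ← pow_mul, ← pow_add, add_comm] at h1
        · rwa [hL, hL, ← pow_mul, ← pow_add, ← two_mul] at h2 }
  have hfixed : Nat.card {z : F // S z = z} = p ^ s := by
    let _ : Fintype (GaloisField p s) := Fintype.ofFinite _
    have hs0 : s ≠ 0 := by omega
    obtain ⟨g⟩ := nonempty_algHom_galoisField hF hs0 (Dvd.intro_left 2 rfl)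
    let _ : Algebra (GaloisField p s) F := g.toRingHom.toAlgebra
    simp_rw [hS]
    rw [← GaloisField.card_eq_pow p hs0]
    exact card_pow_eq_self
  have h2 : (2 : K) ≠ 0 := two_ne_zero_of_odd_prime hodd
  have h2' : (2 : F) ≠ 0 := two_ne_zero_of_odd_prime hodd
  have hsq : ∀ t : ZMod p, IsSquare (algebraMap (ZMod p) K t) :=
    isSquare_algebraMap_zmod hodd hdeven hK (ringChar_ne_two_of_two_ne_zero h2)
  have hn : Even (Module.finrank K F) := by
    have h := Module.card_eq_pow_finrank (K := K) (V := F)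
    rw [hF, hK, ← pow_mul] at h
    have h1 := Nat.pow_right_injective hp.two_le h
    obtain ⟨k, rfl⟩ := hds
    refine ⟨k, Nat.eq_of_mul_eq_mul_left (Nat.pos_of_ne_zero hd0) ?_⟩
    rw [← h1]
    ring
  have hθ : Algebra.trace (ZMod p) K ≠ 0 := Algebra.trace_ne_zero _ _
  have he : (ZMod.stdAddChar : AddChar (ZMod p) ℂ) ≠ 1 := by
    have := ZMod.isPrimitive_stdAddChar p (one_ne_zero (α := ZMod p))
    rwa [AddChar.mulShift_one] at this
  have hτ : (-(ε * p ^ (s + d / 2)) : ℂ) ^ 2 = Fintype.card F * Fintype.card K := by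
    have hε2 : (ε : ℂ) ^ 2 = 1 := by rcases hε with rfl | rfl <;> simp
    obtain ⟨r, rfl⟩ := hdeven
    rw [neg_sq, mul_pow, hε2, hF, hK, one_mul, ← pow_mul, show (r + r) / 2 = r by omega]
    push_cast
    ring
  have hmain := hpair.card_zeroCount_eq hodd he hθ h2 hsq hn hτ
  have hset : (univ : Finset (F × F × F × ZMod p)).filter (fun t =>
        t.1 ^ p ^ s = t.1 ∧ ((suppw p s l t.1 t.2.1 t.2.2.1 t.2.2.2).card : ℤ)
          = (p : ℤ) ^ (s + d / 2 - 1) * ((p : ℤ) - 1) * ((p : ℤ) ^ (s - d / 2) + ε))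
      = univ.filter fun t : F × F × F × ZMod p => S t.1 = t.1 ∧
        (p : ℂ) * zeroCount (Algebra.trace (ZMod p) K) (kasamiForm S L t.1 t.2.1)
          (traceDual K F t.2.2.1) t.2.2.2
          = Fintype.card F + (p - 1) * (-(ε * p ^ (s + d / 2))) := by
    refine filter_congr fun t _ => ?_
    rw [← hS]
    refine and_congr_right fun ha => ?_
    rw [weight_eq_iff_zeroCount hp.ne_zero (by omega) hdeven hdle
      (card_suppw_add_zeroCount hF h2' hS hL ha _ _ _), hF]
  have key : ∀ N : ℕ, 2 * N * Fintype.card K ^ 2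
      = (Fintype.card F - 1) * Nat.card {z : F // S z = z} * Fintype.card F →
      (N : ℚ) = (p : ℚ) ^ (3 * s - 2 * d) * ((p : ℚ) ^ (2 * s) - 1) / 2 := by
    intro N hN
    rw [hfixed, hF, hK] at hN
    have hcast := congrArg (Nat.cast : ℕ → ℚ) hN
    push_cast [Nat.cast_sub (Nat.one_le_pow (2 * s) p hp.pos)] at hcast
    obtain ⟨k, hk⟩ : ∃ k, 3 * s = 2 * d + k := ⟨3 * s - 2 * d, by omega⟩
    have hp0 : (p : ℚ) ≠ 0 := by exact_mod_cast hp.ne_zero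
    have hpk : (p : ℚ) ^ (3 * s) = p ^ (2 * d) * p ^ k := by rw [hk, pow_add]
    rw [hk, Nat.add_sub_cancel_left, eq_div_iff two_ne_zero,
      ← mul_left_inj' (pow_ne_zero (2 * d) hp0)]
    linear_combination hcast + ((p : ℚ) ^ (2 * s) - 1) * hpk
  rw [hset, ← Fintype.card_subtype, ← Nat.card_eq_fintype_card]
  exact key _ hmain
end
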